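/- arXiv:1602.00249 — 3 statements merged into one kernel-verified Lean document; each statement's English description precedes it below -/
import Mathlib

section
/- Let (W⁰, …, W^r; N₁, …, N_r; Y^r) be a Deligne system datum of r variables on V. Then there exist gradings Y^{r−1}, …, Y⁰ of the filtrations W^{r−1}, …, W⁰ respectively, obtained by downward recursion, such that for each j the grading Y^{j−1} is the unique grading of W^{j−1} commuting with Y^j that has the Deligne grading property for (W^{j−1}, N_j, Y^j) (namely: with N̂_j the component of N_j in the 0-eigenspace of ad Y^{j−1}, there exists N̂_j⁺ ∈ End(V) commuting with Y^{j−1} such that (N̂_j⁺, Y^j − Y^{j−1}, N̂_j) is a standard triple and [N_j − N̂_j, N̂_j⁺] = 0); the gradings Y⁰, …, Y^r pairwise commute; and, setting H_j = Y^j − Y^{j−1}, the pairs (N̂_j, H_j) for 1 ≤ j ≤ r are commuting sl₂-pairs: [N̂_i, N̂_j] = 0 and [H_i, H_j] = 0 for all i, j, [H_i, N̂_j] = 0 for i ≠ j, [H_j, N̂_j] = −2N̂_j, and for every ℓ ≥ 0 the map N̂_j^ℓ restricts to an isomorphism from the ℓ-eigenspace of H_j onto the (−ℓ)-eigenspace of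 H_j. -/
/-- An increasing filtration of `V`: an increasing family of subspaces indexed by `ℤ`,
eventually `⊥` below and eventually `⊤` above. -/
def IsIncFilt {K V : Type} [Field K] [AddCommGroup V] [Module K V]
    (W : ℤ → Submodule K V) : Prop :=
  Monotone W ∧ (∃ a : ℤ, ∀ k ≤ a, W k = ⊥) ∧ (∃ b : ℤ, ∀ k, b ≤ k → W k = ⊤)

/-- The `j`-eigenspace `E_j(Y) = ker (Y - j·1)` of an endomorphism, for an integer `j`. -/
def intEig {K V : Type} [Field K] [AddCommGroup V] [Module K V]
    (Y : Module.End K V) (j : ℤ) : Submodule K V :=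
  LinearMap.ker (Y - (j : K) • (1 : Module.End K V))

/-- `Y` is a grading of the filtration `W`: `Y` is semisimple with integer eigenvalues
(`V` is the direct sum of the integer eigenspaces, whose mutual independence is automatic)
and `W k = ⊕_{j ≤ k} E_j(Y)` for all `k`. -/
def IsGrading {K V : Type} [Field K] [AddCommGroup V] [Module K V]
    (Y : Module.End K V) (W : ℤ → Submodule K V) : Prop :=
  (⨆ j : ℤ, intEig Y j) = ⊤ ∧ ∀ k : ℤ, W k = ⨆ j ≤ k, intEig Y j

/-- The adjoint action `ad Y = [Y, ·]` on `End(V)`. -/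
def adE {K V : Type} [Field K] [AddCommGroup V] [Module K V]
    (Y : Module.End K V) : Module.End K (Module.End K V) :=
  LinearMap.mulLeft K Y - LinearMap.mulRight K Y

/-- `M` is the relative weight filtration of `N` with respect to `W`:
`N(M_k) ⊆ M_{k-2}`, and for all `k ∈ ℤ` and `ℓ ≥ 0` the map induced by `N^ℓ` from
`Gr^M_{k+ℓ} Gr^W_k` to `Gr^M_{k-ℓ} Gr^W_k` is an isomorphism (expressed here as surjectivity
and injectivity conditions on the corresponding submodules of `V`). -/
def IsRelWeightFilt {K V : Type} [Field K] [AddCommGroup V] [Module K V]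
    (N : Module.End K V) (W M : ℤ → Submodule K V) : Prop :=
  (∀ k : ℤ, Submodule.map N (M k) ≤ M (k - 2)) ∧
  ∀ (k : ℤ) (ℓ : ℕ),
    (M (k - ℓ) ⊓ W k ≤
      Submodule.map (N ^ ℓ) (M (k + ℓ) ⊓ W k) ⊔ ((M (k - ℓ - 1) ⊓ W k) ⊔ W (k - 1))) ∧
    ((M (k + ℓ) ⊓ W k) ⊓
        Submodule.comap (N ^ ℓ) ((M (k - ℓ - 1) ⊓ W k) ⊔ W (k - 1)) ≤
      (M (k + ℓ - 1) ⊓ W k) ⊔ W (k - 1))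

/-- A one-variable Deligne system `(W, N, Y)`: `W` an increasing filtration, `N` a nilpotent
endomorphism preserving `W`, and `Y` a grading of an increasing filtration `M` of `V` such
that `Y` preserves `W`, `[Y, N] = -2N`, and `M` is the relative weight filtration of `N`
with respect to `W`. -/
def IsDeligneSystem1 {K V : Type} [Field K] [AddCommGroup V] [Module K V]
    (W : ℤ → Submodule K V) (N Y : Module.End K V) : Prop :=
  IsIncFilt W ∧ IsNilpotent N ∧ (∀ k : ℤ, Submodule.map N (W k) ≤ W k) ∧
  ∃ M : ℤ → Submodule K V, IsIncFilt M ∧ IsGrading Y M ∧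
    (∀ k : ℤ, Submodule.map Y (W k) ≤ W k) ∧ (Y * N - N * Y = -(2 • N)) ∧
    IsRelWeightFilt N W M

/-- `N₀` is the component of `N` in the `0`-eigenspace of `ad Y'`: `[Y', N₀] = 0` and
`N - N₀` lies in the sum of the nonzero integer eigenspaces of `ad Y'`. -/
def IsZeroComponent {K V : Type} [Field K] [AddCommGroup V] [Module K V]
    (Y' N N₀ : Module.End K V) : Prop :=
  adE Y' N₀ = 0 ∧
  N - N₀ ∈ ⨆ j ∈ {j : ℤ | j ≠ 0},
    LinearMap.ker (adE Y' - (j : K) • (1 : Module.End K (Module.End K V)))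

/-- `(N⁺, Y, N)` is a standard triple: `[Y, N⁺] = 2N⁺`, `[N⁺, N] = Y`, `[Y, N] = -2N`. -/
def IsStdTriple {K V : Type} [Field K] [AddCommGroup V] [Module K V]
    (Np Y N : Module.End K V) : Prop :=
  Y * Np - Np * Y = 2 • Np ∧ Np * N - N * Np = Y ∧ Y * N - N * Y = -(2 • N)

/-- `Y'` has the Deligne grading property for `(N, Y)`: there exist `N₀⁺` commuting with `Y'`
such that `(N₀⁺, Y - Y', N₀)` is a standard triple and `[N - N₀, N₀⁺] = 0`, where `N₀` is the
component of `N` in the `0`-eigenspace of `ad Y'`. -/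
def HasDGP {K V : Type} [Field K] [AddCommGroup V] [Module K V]
    (N Y Y' : Module.End K V) : Prop :=
  ∃ N₀ Np : Module.End K V, IsZeroComponent Y' N N₀ ∧ adE Y' Np = 0 ∧
    IsStdTriple Np (Y - Y') N₀ ∧ (N - N₀) * Np = Np * (N - N₀)

section Eigenspaces

variable {K V V₁ V₂ : Type} [Field K] [AddCommGroup V] [Module K V]
  [AddCommGroup V₁] [Module K V₁] [AddCommGroup V₂] [Module K V₂]

theorem mem_intEig {Y : Module.End K V} {j : ℤ} {v : V} :
    v ∈ intEig Y j ↔ Y v = (j : K) • v := by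
  simp [intEig, sub_eq_zero]

/-- The part `⊕_{j ≤ m} E_j(Y)` of `V`. -/
def lowEig (Y : Module.End K V) (m : ℤ) : Submodule K V := ⨆ j ≤ m, intEig Y j

theorem intEig_le_lowEig (Y : Module.End K V) {j m : ℤ} (h : j ≤ m) :
    intEig Y j ≤ lowEig Y m :=
  le_iSup₂_of_le j h le_rfl

theorem lowEig_le {Y : Module.End K V} {m : ℤ} {U : Submodule K V}
    (h : ∀ j ≤ m, intEig Y j ≤ U) : lowEig Y m ≤ U :=
  iSup₂_le h

theorem lowEig_mono (Y : Module.End K V) : Monotone (lowEig Y) :=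
  fun _ _ h => lowEig_le fun _ hj => intEig_le_lowEig Y (hj.trans h)

theorem iSupIndep_intEig [CharZero K] (Y : Module.End K V) : iSupIndep (intEig Y) := by
  have h : intEig Y = (Module.End.eigenspace Y) ∘ (fun j : ℤ => (j : K)) := by
    funext j
    ext v
    simp [mem_intEig]
  rw [h]
  exact (Module.End.eigenspaces_iSupIndep Y).comp Int.cast_injective

open Classical in
/-- The projection of `V` onto `E_j(Y)` along the other integer eigenspaces of `Y`. -/
noncomputable def intProj (Y : Module.End K V) (j : ℤ) : Module.End K V :=
  if h : IsCompl (intEig Y j) (⨆ i ≠ j, intEig Y i) then Submodule.projection _ _ h else 0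

theorem intProj_mem (Y : Module.End K V) (j : ℤ) (v : V) : intProj Y j v ∈ intEig Y j := by
  unfold intProj
  split_ifs with h
  · exact Submodule.projection_apply_mem h v
  · exact zero_mem _

theorem intProj_of_mem_iSup_ne {Y : Module.End K V} {j : ℤ} {v : V}
    (hv : v ∈ ⨆ i ≠ j, intEig Y i) : intProj Y j v = 0 := by
  rw [intProj]
  split_ifs with h
  · exact (Submodule.projection_apply_eq_zero_iff _).2 hv
  · rfl

theorem intProj_of_mem_ne {Y : Module.End K V} {i j : ℤ} (h : i ≠ j) {v : V}
    (hv : v ∈ intEig Y i) : intProj Y j v = 0 :=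
  intProj_of_mem_iSup_ne ((le_iSup₂_of_le i h le_rfl : intEig Y i ≤ _) hv)

theorem intProj_of_mem_lowEig {Y : Module.End K V} {m j : ℤ} (h : m < j) {v : V}
    (hv : v ∈ lowEig Y m) : intProj Y j v = 0 := by
  have : lowEig Y m ≤ LinearMap.ker (intProj Y j) :=
    lowEig_le fun i hi w hw => intProj_of_mem_ne (by omega) hw
  exact this hv

theorem apply_intProj (Y : Module.End K V) (j : ℤ) (v : V) :
    Y (intProj Y j v) = (j : K) • intProj Y j v :=
  mem_intEig.1 (intProj_mem Y j v)

theorem exists_intEig_eq_bot [CharZero K] [FiniteDimensional K V] (Y : Module.End K V) :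
    ∃ n : ℕ, ∀ j : ℤ, (n : ℤ) < |j| → intEig Y j = ⊥ := by
  have h := Submodule.finite_ne_bot_of_iSupIndep (iSupIndep_intEig Y)
  obtain ⟨n, hn⟩ := (h.image Int.natAbs).bddAbove
  refine ⟨n, fun j hj => ?_⟩
  by_contra hne
  have : j.natAbs ≤ n := hn ⟨j, hne, rfl⟩
  rw [Int.abs_eq_natAbs] at hj
  omega

theorem intEig_hom_ext {Y : Module.End K V₁} (hY : ⨆ j, intEig Y j = ⊤) {f g : V₁ →ₗ[K] V₂}
    (h : ∀ j, ∀ v ∈ intEig Y j, f v = g v) : f = g := by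
  have : (⊤ : Submodule K V₁) ≤ LinearMap.eqLocus f g := by
    rw [← hY]
    exact iSup_le fun j v hv => h j v hv
  ext v
  exact this (Submodule.mem_top (x := v))

variable [CharZero K]

theorem isCompl_intEig {Y : Module.End K V} (hY : ⨆ j, intEig Y j = ⊤) (j : ℤ) :
    IsCompl (intEig Y j) (⨆ i ≠ j, intEig Y i) := by
  refine ⟨iSupIndep_intEig Y j, codisjoint_iff_le_sup.2 ?_⟩
  rw [← hY]
  refine iSup_le fun i => ?_
  by_cases h : i = j
  · subst h; exact le_sup_left
  · exact le_sup_of_le_right (le_iSup₂_of_le i h le_rfl)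

theorem intProj_of_mem {Y : Module.End K V} (hY : ⨆ j, intEig Y j = ⊤) {j : ℤ} {v : V}
    (hv : v ∈ intEig Y j) : intProj Y j v = v := by
  rw [intProj, dif_pos (isCompl_intEig hY j)]
  exact Submodule.projection_apply_of_mem_left _ hv

theorem intProj_shift {A : Module.End K V₁} {B : Module.End K V₂}
    (hA : ⨆ j, intEig A j = ⊤) (hB : ⨆ j, intEig B j = ⊤) {f : V₁ →ₗ[K] V₂} {c : ℤ}
    (hf : ∀ v, B (f v) = f (A v) + (c : K) • f v) (j : ℤ) (v : V₁) :
    intProj B (j + c) (f v) = f (intProj A j v) := by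
  have : intProj B (j + c) ∘ₗ f = f ∘ₗ intProj A j := by
    refine intEig_hom_ext hA fun i w hw => ?_
    have hfw : f w ∈ intEig B (i + c) := by
      rw [mem_intEig] at hw ⊢
      rw [hf, hw, map_smul, Int.cast_add, add_smul]
    simp only [LinearMap.comp_apply]
    by_cases h : i = j
    · subst h
      rw [intProj_of_mem hB hfw, intProj_of_mem hA hw]
    · rw [intProj_of_mem_ne (by omega) hfw, intProj_of_mem_ne h hw, map_zero]
  exact LinearMap.congr_fun this v

theorem intProj_comm {Y : Module.End K V} (hY : ⨆ j, intEig Y j = ⊤) {f : Module.End K V}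
    (hf : ∀ v, Y (f v) = f (Y v)) (j : ℤ) (v : V) :
    intProj Y j (f v) = f (intProj Y j v) := by
  have := intProj_shift (c := 0) hY hY (f := f) (by simpa using hf) j v
  simpa using this

theorem exists_sum_intProj [FiniteDimensional K V] {Y : Module.End K V}
    (hY : ⨆ j, intEig Y j = ⊤) :
    ∃ n : ℕ, (∀ j : ℤ, (n : ℤ) < |j| → intEig Y j = ⊥) ∧
      ∀ v, ∑ j ∈ Finset.Icc (-(n : ℤ)) n, intProj Y j v = v := by
  obtain ⟨n, hn⟩ := exists_intEig_eq_bot Y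
  refine ⟨n, hn, fun v => ?_⟩
  have : ∑ j ∈ Finset.Icc (-(n : ℤ)) n, intProj Y j = LinearMap.id := by
    refine intEig_hom_ext hY fun i w hw => ?_
    rw [LinearMap.sum_apply]
    by_cases hi : (n : ℤ) < |i|
    · rw [hn i hi, Submodule.mem_bot] at hw
      simp [hw]
    · rw [Finset.sum_eq_single i]
      · exact intProj_of_mem hY hw
      · exact fun j _ hj => intProj_of_mem_ne hj.symm hw
      · intro h
        rw [Finset.mem_Icc, ← abs_le] at h
        omega
  simpa using LinearMap.congr_fun this v

theorem mem_of_intProj_mem [FiniteDimensional K V] {Y : Module.End K V}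
    (hY : ⨆ j, intEig Y j = ⊤) {U : Submodule K V} {v : V} (h : ∀ j, intProj Y j v ∈ U) :
    v ∈ U := by
  obtain ⟨n, -, hn⟩ := exists_sum_intProj hY
  rw [← hn v]
  exact Submodule.sum_mem _ fun j _ => h j

theorem mem_lowEig_iff [FiniteDimensional K V] {Y : Module.End K V}
    (hY : ⨆ j, intEig Y j = ⊤) {m : ℤ} {v : V} :
    v ∈ lowEig Y m ↔ ∀ j, m < j → intProj Y j v = 0 := by
  refine ⟨fun h j hj => intProj_of_mem_lowEig hj h, fun h => mem_of_intProj_mem hY fun j => ?_⟩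
  by_cases hj : m < j
  · rw [h j hj]; exact zero_mem _
  · exact intEig_le_lowEig Y (not_lt.1 hj) (intProj_mem Y j v)

theorem mem_lowEig_sub_one [FiniteDimensional K V] {Y : Module.End K V}
    (hY : ⨆ j, intEig Y j = ⊤) {m : ℤ} {v : V} (hv : v ∈ lowEig Y m)
    (h : intProj Y m v = 0) : v ∈ lowEig Y (m - 1) := by
  rw [mem_lowEig_iff hY] at hv ⊢
  intro j hj
  rcases eq_or_lt_of_le (show m ≤ j by omega) with rfl | h'
  · exact h
  · exact hv j h'

theorem sub_intProj_mem_lowEig [FiniteDimensional K V] {Y : Module.End K V}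
    (hY : ⨆ j, intEig Y j = ⊤) {m : ℤ} {v : V} (hv : v ∈ lowEig Y m) :
    v - intProj Y m v ∈ lowEig Y (m - 1) := by
  refine mem_lowEig_sub_one hY
    (sub_mem hv (intEig_le_lowEig Y le_rfl (intProj_mem Y m v))) ?_
  rw [map_sub, intProj_of_mem hY (intProj_mem Y m v), sub_self]

theorem intProj_mem_of_forall_mem [FiniteDimensional K V] {Y : Module.End K V}
    (hY : ⨆ j, intEig Y j = ⊤) {U : Submodule K V} (hU : ∀ u ∈ U, Y u ∈ U) (j : ℤ) {u : V}
    (hu : u ∈ U) : intProj Y j u ∈ U := by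
  have htop : ⨆ μ : K, Y.genEigenspace μ 1 = ⊤ := by
    refine top_le_iff.1 (hY ▸ iSup_le fun i w hw => ?_)
    refine (le_iSup (fun μ : K => Y.genEigenspace μ 1) (i : K)) ?_
    exact Module.End.mem_eigenspace_iff.2 (mem_intEig.1 hw)
  have hsplit := Submodule.inf_iSup_genEigenspace hU 1
  rw [htop, inf_top_eq] at hsplit
  have hle : U ≤ U.comap (intProj Y j) := by
    conv_lhs => rw [hsplit]
    refine iSup_le fun μ w hw => ?_
    have hμ : Y w = μ • w := Module.End.mem_eigenspace_iff.1 hw.2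
    have h₁ := intProj_comm hY (f := Y) (fun _ => rfl) j w
    rw [apply_intProj, hμ, map_smul] at h₁
    rw [Submodule.mem_comap]
    by_cases h : μ = j
    · rw [intProj_of_mem hY (mem_intEig.2 (h ▸ hμ))]
      exact hw.1
    · rw [← sub_eq_zero, ← sub_smul, smul_eq_zero, sub_eq_zero, or_iff_right h] at h₁
      rw [h₁]
      exact zero_mem _
  exact hle hu

theorem lowEig_eq_bot_top [FiniteDimensional K V] {Y : Module.End K V}
    (hY : ⨆ j, intEig Y j = ⊤) :
    ∃ n : ℕ, lowEig Y (-n) = ⊥ ∧ lowEig Y n = ⊤ := by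
  obtain ⟨n, hn, hs⟩ := exists_sum_intProj hY
  refine ⟨n + 1, ?_, ?_⟩
  · refine le_bot_iff.1 (lowEig_le fun j hj => (hn j ?_).le)
    rw [lt_abs]; right; push_cast at hj; omega
  · refine top_le_iff.1 fun v _ => ?_
    rw [mem_lowEig_iff hY]
    intro j hj
    have := intProj_mem Y j v
    rwa [hn j (by rw [lt_abs]; left; push_cast at hj; omega), Submodule.mem_bot] at this

end Eigenspaces

section HomAd

variable {K V₁ V₂ : Type} [Field K] [AddCommGroup V₁] [Module K V₁] [AddCommGroup V₂]
  [Module K V₂]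

/-- The operator `f ↦ B ∘ f - f ∘ A` on `Hom(V₁, V₂)`. -/
def homAd (A : Module.End K V₁) (B : Module.End K V₂) : Module.End K (V₁ →ₗ[K] V₂) where
  toFun f := B ∘ₗ f - f ∘ₗ A
  map_add' f g := by ext v; simp; abel
  map_smul' c f := by ext v; simp [smul_sub]

theorem homAd_apply (A : Module.End K V₁) (B : Module.End K V₂) (f : V₁ →ₗ[K] V₂) (v : V₁) :
    homAd A B f v = B (f v) - f (A v) := rfl

theorem adE_eq_zero_iff {A f : Module.End K V₁} : adE A f = 0 ↔ Commute A f := by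
  simp [adE, sub_eq_zero, Commute, SemiconjBy]

theorem homAd_sub (A A' : Module.End K V₁) (B B' : Module.End K V₂) :
    homAd (A - A') (B - B') = homAd A B - homAd A' B' := by
  ext f v
  simp only [homAd_apply, LinearMap.sub_apply, map_sub]
  abel

theorem homAd_mul_sub_mul (A A' : Module.End K V₁) (B B' : Module.End K V₂) :
    homAd A B * homAd A' B' - homAd A' B' * homAd A B
      = homAd (A * A' - A' * A) (B * B' - B' * B) := by
  ext f v
  simp only [homAd_apply, LinearMap.sub_apply, Module.End.mul_apply, map_sub]
  abel

theorem commute_homAd {A A' : Module.End K V₁} {B B' : Module.End K V₂} (hA : Commute A A')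
    (hB : Commute B B') : Commute (homAd A B) (homAd A' B') := by
  have := homAd_mul_sub_mul A A' B B'
  rw [hA.eq, hB.eq, sub_self, sub_self] at this
  refine sub_eq_zero.1 (this.trans ?_)
  ext f v
  simp [homAd_apply]

theorem IsStdTriple.homAd {e₁ h₁ f₁ : Module.End K V₁} {e₂ h₂ f₂ : Module.End K V₂}
    (t₁ : IsStdTriple e₁ h₁ f₁) (t₂ : IsStdTriple e₂ h₂ f₂) :
    IsStdTriple (homAd e₁ e₂) (homAd h₁ h₂) (homAd f₁ f₂) := by
  obtain ⟨a₁, b₁, c₁⟩ := t₁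
  obtain ⟨a₂, b₂, c₂⟩ := t₂
  refine ⟨?_, ?_, ?_⟩
  · rw [homAd_mul_sub_mul, a₁, a₂]
    ext f v
    simp [homAd_apply, smul_sub]
  · rw [homAd_mul_sub_mul, b₁, b₂]
  · rw [homAd_mul_sub_mul, c₁, c₂]
    ext f v
    simp [homAd_apply, smul_sub]
    abel

theorem mem_intEig_homAd {A : Module.End K V₁} {B : Module.End K V₂} {f : V₁ →ₗ[K] V₂} {c : ℤ} :
    f ∈ intEig (homAd A B) c ↔ ∀ v, B (f v) = f (A v) + (c : K) • f v := by
  rw [mem_intEig, LinearMap.ext_iff]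
  refine forall_congr' fun v => ?_
  rw [homAd_apply, LinearMap.smul_apply, sub_eq_iff_eq_add, add_comm]

theorem apply_mem_intEig {A : Module.End K V₁} {B : Module.End K V₂} {f : V₁ →ₗ[K] V₂} {c j : ℤ}
    (hf : f ∈ intEig (homAd A B) c) {v : V₁} (hv : v ∈ intEig A j) :
    f v ∈ intEig B (j + c) := by
  rw [mem_intEig_homAd] at hf
  rw [mem_intEig] at hv ⊢
  rw [hf, hv, map_smul, Int.cast_add, add_smul]

theorem apply_mem_lowEig {A : Module.End K V₁} {B : Module.End K V₂} {f : V₁ →ₗ[K] V₂} {m k : ℤ}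
    (hf : f ∈ lowEig (homAd A B) m) {v : V₁} (hv : v ∈ lowEig A k) :
    f v ∈ lowEig B (k + m) := by
  have key : lowEig A k ≤ (lowEig B (k + m)).comap f := by
    refine lowEig_le fun j hj w hw => ?_
    have : lowEig (homAd A B) m ≤ (lowEig B (k + m)).comap (LinearMap.applyₗ w) :=
      lowEig_le fun i hi g hg => intEig_le_lowEig B (by omega) (apply_mem_intEig hg hw)
    exact this hf
  exact key hv

variable [CharZero K] [FiniteDimensional K V₁] [FiniteDimensional K V₂]

theorem mem_lowEig_homAd {A : Module.End K V₁} {B : Module.End K V₂}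
    (hA : ⨆ j, intEig A j = ⊤) (hB : ⨆ j, intEig B j = ⊤) {f : V₁ →ₗ[K] V₂} {m : ℤ}
    (hf : ∀ k, ∀ v ∈ lowEig A k, f v ∈ lowEig B (k + m)) : f ∈ lowEig (homAd A B) m := by
  obtain ⟨n₁, -, h₁⟩ := exists_sum_intProj hA
  obtain ⟨n₂, -, h₂⟩ := exists_sum_intProj hB
  have : f = ∑ i ∈ Finset.Icc (-(n₂ : ℤ)) n₂, ∑ j ∈ Finset.Icc (-(n₁ : ℤ)) n₁,
      intProj B i ∘ₗ f ∘ₗ intProj A j := by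
    ext v
    simp only [LinearMap.sum_apply, LinearMap.comp_apply]
    simp_rw [← map_sum, h₁, h₂]
  rw [this]
  refine Submodule.sum_mem _ fun i _ => Submodule.sum_mem _ fun j _ => ?_
  by_cases hij : i ≤ j + m
  · refine intEig_le_lowEig _ (j := i - j) (by omega) (mem_intEig_homAd.2 fun v => ?_)
    have hv : intProj A j (A v) = (j : K) • intProj A j v := by
      rw [intProj_comm hA (f := A) (fun _ => rfl), apply_intProj]
    simp only [LinearMap.comp_apply]
    rw [apply_intProj, hv, map_smul, map_smul, ← add_smul]
    push_cast
    congr 1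
    ring
  · have hzero : intProj B i ∘ₗ f ∘ₗ intProj A j = 0 := LinearMap.ext fun v =>
      intProj_of_mem_lowEig (not_le.1 hij)
        (hf j _ (intEig_le_lowEig A le_rfl (intProj_mem A j v)))
    rw [hzero]
    exact zero_mem _

theorem iSup_intEig_homAd {A : Module.End K V₁} {B : Module.End K V₂}
    (hA : ⨆ j, intEig A j = ⊤) (hB : ⨆ j, intEig B j = ⊤) : ⨆ j, intEig (homAd A B) j = ⊤ := by
  refine top_le_iff.1 fun f _ => ?_
  obtain ⟨a, ha, -⟩ := lowEig_eq_bot_top hA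
  obtain ⟨b, -, hb⟩ := lowEig_eq_bot_top hB
  have : f ∈ lowEig (homAd A B) (a + b) := by
    refine mem_lowEig_homAd hA hB fun k v hv => ?_
    by_cases hk : k ≤ -a
    · have hv' := lowEig_mono A hk hv
      rw [ha, Submodule.mem_bot] at hv'
      rw [hv', map_zero]
      exact zero_mem _
    · have : lowEig B b ≤ lowEig B (k + (a + b)) := lowEig_mono B (by omega)
      rw [hb] at this
      exact this Submodule.mem_top
  exact lowEig_le (fun j _ => le_iSup (intEig (homAd A B)) j) this

end HomAd

section SlTwo

variable {K E : Type} [Field K] [AddCommGroup E] [Module K E] {e h f : Module.End K E}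

theorem IsStdTriple.apply_e (t : IsStdTriple e h f) (v : E) :
    h (e v) = e (h v) + (2 : K) • e v := by
  have := LinearMap.congr_fun t.1 v
  simp only [LinearMap.sub_apply, Module.End.mul_apply, LinearMap.smul_apply] at this
  rw [sub_eq_iff_eq_add'] at this
  rw [this, ofNat_smul_eq_nsmul K 2 (e v)]

theorem IsStdTriple.apply_f (t : IsStdTriple e h f) (v : E) :
    h (f v) = f (h v) - (2 : K) • f v := by
  have := LinearMap.congr_fun t.2.2 v
  simp only [LinearMap.sub_apply, Module.End.mul_apply, LinearMap.neg_apply,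
    LinearMap.smul_apply] at this
  rw [sub_eq_iff_eq_add'] at this
  rw [this, ofNat_smul_eq_nsmul K 2 (f v), sub_eq_add_neg]

theorem IsStdTriple.apply_f_e (t : IsStdTriple e h f) (v : E) : f (e v) = e (f v) - h v := by
  have := LinearMap.congr_fun t.2.1 v
  simp only [LinearMap.sub_apply, Module.End.mul_apply] at this
  rw [← this]; abel

theorem intProj_pow_apply [CharZero K] (hh : ⨆ j, intEig h j = ⊤) (hhf : h * f - f * h = -(2 • f))
    (j : ℤ) (ℓ : ℕ) (v : E) :
    intProj h (j - 2 * ℓ) ((f ^ ℓ) v) = (f ^ ℓ) (intProj h j v) := by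
  have hf : ∀ v, h (f v) = f (h v) + ((-2 : ℤ) : K) • f v := fun v => by
    have := LinearMap.congr_fun hhf v
    simp only [LinearMap.sub_apply, Module.End.mul_apply, LinearMap.neg_apply,
      LinearMap.smul_apply] at this
    rw [sub_eq_iff_eq_add'] at this
    rw [this, Int.cast_smul_eq_zsmul, neg_smul, ofNat_zsmul]
  induction ℓ with
  | zero => simp
  | succ ℓ ih =>
    rw [pow_succ', Module.End.mul_apply, Module.End.mul_apply, ← ih, ← intProj_shift hh hh hf]
    congr 2
    push_cast
    ring

theorem trace_intProj_mul_eq [CharZero K] (hh : ⨆ j, intEig h j = ⊤)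
    (hhf : h * f - f * h = -(2 • f))
    (hinj : ∀ ℓ : ℕ, ∀ v ∈ intEig h ℓ, (f ^ ℓ) v = 0 → v = 0)
    (hsurj : ∀ ℓ : ℕ, ∀ v ∈ intEig h (-ℓ), ∃ u ∈ intEig h ℓ, (f ^ ℓ) u = v)
    {z : Module.End K E} (hz : Commute z f) (ℓ : ℕ) :
    LinearMap.trace K E (intProj h ℓ * z) = LinearMap.trace K E (intProj h (-ℓ) * z) := by
  have hshift : ∀ v, intProj h (-ℓ) ((f ^ ℓ) v) = (f ^ ℓ) (intProj h ℓ v) := fun v => by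
    rw [← intProj_pow_apply hh hhf]
    congr 2
    ring
  have hmaps : ∀ v ∈ intEig h ℓ, (f ^ ℓ) v ∈ intEig h (-ℓ) := fun v hv => by
    rw [← intProj_of_mem hh hv, ← hshift]
    exact intProj_mem _ _ _
  let φ : intEig h ℓ ≃ₗ[K] intEig h (-ℓ) := LinearEquiv.ofBijective ((f ^ ℓ).restrict hmaps) <| by
    constructor
    · rw [← LinearMap.ker_eq_bot, LinearMap.ker_eq_bot']
      exact fun v hv => Subtype.ext (hinj ℓ v v.2 (congrArg Subtype.val hv))
    · rintro ⟨v, hv⟩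
      obtain ⟨u, hu, rfl⟩ := hsurj ℓ v hv
      exact ⟨⟨u, hu⟩, rfl⟩
  have hφ : ∀ u, ((φ u : intEig h (-ℓ)) : E) = (f ^ ℓ) u := fun u => rfl
  let G : Module.End K E := (intEig h ℓ).subtype ∘ₗ φ.symm.toLinearMap ∘ₗ
    (intProj h (-ℓ)).codRestrict _ (intProj_mem h (-ℓ))
  have h₁ : intProj h ℓ = G * f ^ ℓ := by
    ext v
    have : (intProj h (-ℓ)).codRestrict _ (intProj_mem h (-ℓ)) ((f ^ ℓ) v)
        = φ ⟨_, intProj_mem h ℓ v⟩ := Subtype.ext (hshift v)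
    simp [G, this]
  have h₂ : intProj h (-ℓ) = f ^ ℓ * G := by
    ext v
    simp [G, ← hφ]
  rw [h₁, mul_assoc, ← (hz.pow_right ℓ).eq, ← mul_assoc, LinearMap.trace_mul_comm, ← mul_assoc,
    ← h₂]

variable [FiniteDimensional K E]

theorem eq_zero_of_trace_mul_eq_zero {z : Module.End K E}
    (hz : ∀ x, LinearMap.trace K E (z * x) = 0) : z = 0 := by
  ext v
  refine (Module.forall_dual_apply_eq_zero_iff K (z v)).1 fun g => ?_
  have h₁ : z * g.smulRight v = g.smulRight (z v) := by
    ext w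
    simp
  have h₂ := hz (g.smulRight v)
  rwa [h₁, LinearMap.trace_smulRight] at h₂

theorem exists_eq_trace_mul (φ : Module.End K E →ₗ[K] K) :
    ∃ z : Module.End K E, ∀ x, φ x = LinearMap.trace K E (z * x) := by
  let T : Module.End K E →ₗ[K] Module.Dual K (Module.End K E) :=
    (LinearMap.mul K (Module.End K E)).compr₂ (LinearMap.trace K E)
  have hinj : Function.Injective T := by
    rw [← LinearMap.ker_eq_bot, LinearMap.ker_eq_bot']
    exact fun z hz => eq_zero_of_trace_mul_eq_zero fun x => LinearMap.congr_fun hz x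
  have hsurj : Function.Surjective T :=
    (LinearMap.injective_iff_surjective_of_finrank_eq_finrank
      (Subspace.dual_finrank_eq).symm).1 hinj
  obtain ⟨z, hz⟩ := hsurj φ
  exact ⟨z, fun x => by rw [← hz]; rfl⟩

variable [CharZero K]

theorem IsStdTriple.eq_zero_of_e_f (t : IsStdTriple e h f) {k : ℤ} (hk : 0 < k) {v : E}
    (hv : h v = (k : K) • v) (hef : e (f v) = 0) : v = 0 := by
  have hw : ∀ n : ℕ, h ((e ^ n) v) = ((k + 2 * n : ℤ) : K) • (e ^ n) v := by
    intro n
    induction n with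
    | zero => simpa using hv
    | succ n ih =>
      rw [pow_succ', Module.End.mul_apply, t.apply_e, ih, map_smul, ← add_smul]
      push_cast
      congr 1
      ring
  have hc : ∀ n : ℕ, e (f ((e ^ n) v)) = -((n * (k + n - 1) : ℤ) : K) • (e ^ n) v := by
    intro n
    induction n with
    | zero => simpa using hef
    | succ n ih =>
      rw [pow_succ', Module.End.mul_apply, t.apply_f_e, ih, hw, ← sub_smul, map_smul]
      push_cast
      congr 1
      ring
  have hback : ∀ n : ℕ, (e ^ (n + 1)) v = 0 → (e ^ n) v = 0 := by
    intro n hn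
    have h₁ := t.apply_f_e ((e ^ n) v)
    rw [← Module.End.mul_apply e, ← pow_succ', hn, map_zero, hc, hw, ← sub_smul, eq_comm,
      smul_eq_zero] at h₁
    refine h₁.resolve_left ?_
    have h₂ : (-((n * (k + n - 1) : ℤ) : K) - ((k + 2 * n : ℤ) : K))
        = ((-((n + 1) * (k + n)) : ℤ) : K) := by
      push_cast; ring
    rw [h₂, Int.cast_eq_zero]
    have : 0 < ((n : ℤ) + 1) * (k + n) := by positivity
    omega
  obtain ⟨n, hn⟩ := exists_intEig_eq_bot h
  have hlast : (e ^ n) v = 0 := by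
    have : (e ^ n) v ∈ intEig h (k + 2 * n) := mem_intEig.2 (hw n)
    rwa [hn _ (by rw [lt_abs]; left; omega), Submodule.mem_bot] at this
  clear hn
  induction n with
  | zero => simpa using hlast
  | succ n ih => exact ih (hback n hlast)

theorem IsStdTriple.apply_e_eq_zero (t : IsStdTriple e h f) {v : E} (hv : h v = 0)
    (hf : f v = 0) : e v = 0 := by
  refine t.eq_zero_of_e_f (k := 2) (by norm_num) ?_ ?_
  · rw [t.apply_e, hv, map_zero, zero_add]; norm_cast
  · rw [t.apply_f_e, hv, hf]; simp

theorem IsStdTriple.exists_e_sub_eq_zero (t : IsStdTriple e h f) {k : ℤ} (hk : 0 < k) {v : E}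
    (hv : h v = ((k - 2 : ℤ) : K) • v) : ∃ g : E, h g = (k : K) • g ∧ e (v - f g) = 0 := by
  have hmaps : ∀ x ∈ intEig h k, (e * f) x ∈ intEig h k := by
    intro x hx
    rw [mem_intEig] at hx ⊢
    rw [Module.End.mul_apply, t.apply_e, t.apply_f, hx]
    simp
  have hinj : Function.Injective ((e * f).restrict hmaps) := by
    rw [← LinearMap.ker_eq_bot, LinearMap.ker_eq_bot']
    intro x hx
    exact Subtype.ext (t.eq_zero_of_e_f hk (mem_intEig.1 x.2) (congrArg Subtype.val hx))
  have hev : e v ∈ intEig h k := by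
    rw [mem_intEig, t.apply_e, hv, map_smul, ← add_smul]
    push_cast
    congr 1
    ring
  obtain ⟨x, hx⟩ := LinearMap.injective_iff_surjective.1 hinj ⟨e v, hev⟩
  refine ⟨x, mem_intEig.1 x.2, ?_⟩
  have : e (f x) = e v := congrArg Subtype.val hx
  rw [map_sub, this, sub_self]

theorem trace_mul_eq_zero_of_commute (hh : ⨆ j, intEig h j = ⊤)
    (hhf : h * f - f * h = -(2 • f))
    (hinj : ∀ ℓ : ℕ, ∀ v ∈ intEig h ℓ, (f ^ ℓ) v = 0 → v = 0)
    (hsurj : ∀ ℓ : ℕ, ∀ v ∈ intEig h (-ℓ), ∃ u ∈ intEig h ℓ, (f ^ ℓ) u = v)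
    {z : Module.End K E} (hz : Commute z f) : LinearMap.trace K E (h * z) = 0 := by
  obtain ⟨n, -, hn⟩ := exists_sum_intProj hh
  have hsum : h = ∑ j ∈ Finset.Icc (-(n : ℤ)) n, (j : K) • intProj h j := by
    ext v
    conv_lhs => rw [← hn v, map_sum]
    simp only [LinearMap.sum_apply, LinearMap.smul_apply, apply_intProj]
  have hsymm : ∀ j : ℤ, LinearMap.trace K E (intProj h (-j) * z)
      = LinearMap.trace K E (intProj h j * z) := by
    intro j
    obtain ⟨ℓ, rfl | rfl⟩ := j.eq_nat_or_neg
    · exact (trace_intProj_mul_eq hh hhf hinj hsurj hz ℓ).symm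
    · rw [neg_neg]
      exact trace_intProj_mul_eq hh hhf hinj hsurj hz ℓ
  have htr : LinearMap.trace K E (h * z) = ∑ j ∈ Finset.Icc (-(n : ℤ)) n,
      (j : K) * LinearMap.trace K E (intProj h j * z) := by
    conv_lhs => rw [hsum]
    simp [Finset.sum_mul]
  have hneg : ∑ j ∈ Finset.Icc (-(n : ℤ)) n, (j : K) * LinearMap.trace K E (intProj h j * z)
      = ∑ j ∈ Finset.Icc (-(n : ℤ)) n, -((j : K) * LinearMap.trace K E (intProj h j * z)) := by
    refine Finset.sum_equiv (Equiv.neg ℤ) (fun j => ?_) fun j _ => ?_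
    · simp only [Finset.mem_Icc, Equiv.neg_apply]
      omega
    · rw [Equiv.neg_apply, hsymm]
      push_cast
      ring
  rw [Finset.sum_neg_distrib, ← htr] at hneg
  exact self_eq_neg.1 hneg

/-- A Jacobson–Morozov statement: an `sl₂`-pair `(f, h)` extends to a standard triple. -/
theorem exists_isStdTriple (hh : ⨆ j, intEig h j = ⊤) (hhf : h * f - f * h = -(2 • f))
    (hinj : ∀ ℓ : ℕ, ∀ v ∈ intEig h ℓ, (f ^ ℓ) v = 0 → v = 0)
    (hsurj : ∀ ℓ : ℕ, ∀ v ∈ intEig h (-ℓ), ∃ u ∈ intEig h ℓ, (f ^ ℓ) u = v) :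
    ∃ e, IsStdTriple e h f := by
  have hrange : h ∈ LinearMap.range (homAd f f) := by
    by_contra hnot
    obtain ⟨φ, hφh, hφ⟩ := Submodule.exists_le_ker_of_notMem hnot
    obtain ⟨z, hz⟩ := exists_eq_trace_mul φ
    have hcomm : Commute z f := by
      refine sub_eq_zero.1 (eq_zero_of_trace_mul_eq_zero fun x => ?_)
      have h₁ : LinearMap.trace K E (z * (f * x - x * f)) = 0 := by
        rw [← hz]
        exact hφ ⟨x, rfl⟩
      rw [mul_sub, map_sub, ← mul_assoc z x f, LinearMap.trace_mul_comm K (z * x) f] at h₁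
      rw [sub_mul, map_sub, mul_assoc, mul_assoc]
      exact h₁
    refine hφh ?_
    rw [hz, LinearMap.trace_mul_comm]
    exact trace_mul_eq_zero_of_commute hh hhf hinj hsurj hcomm
  obtain ⟨x, hx⟩ := hrange
  have hD := iSup_intEig_homAd hh hh
  have hshift := intProj_shift (f := homAd f f) (c := -2) hD hD (fun v => by
    have := LinearMap.congr_fun (homAd_mul_sub_mul h f h f) v
    rw [hhf, LinearMap.sub_apply, sub_eq_iff_eq_add'] at this
    refine this.trans ?_
    congr 1
    ext w
    simp only [homAd_apply, LinearMap.neg_apply, LinearMap.smul_apply, map_neg, map_nsmul]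
    rw [Int.cast_smul_eq_zsmul, neg_smul, ofNat_zsmul, smul_sub]
    abel) 2 (-x)
  have hh₀ : homAd f f (-x) ∈ intEig (homAd h h) (2 + -2) := by
    rw [map_neg, hx, mem_intEig]
    ext w
    simp [homAd_apply]
  rw [intProj_of_mem hD hh₀, map_neg, hx] at hshift
  refine ⟨intProj (homAd h h) 2 (-x), ?_, ?_, hhf⟩
  · refine (apply_intProj (homAd h h) 2 (-x)).trans ?_
    rw [Int.cast_ofNat, ofNat_smul_eq_nsmul]
  · rw [← neg_sub, eq_comm, ← neg_eq_iff_eq_neg]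
    exact hshift

end SlTwo

section DeligneSplit

variable {K V V₁ V₂ : Type} [Field K] [AddCommGroup V] [Module K V]
  [AddCommGroup V₁] [Module K V₁] [AddCommGroup V₂] [Module K V₂]

theorem IsGrading.eq_lowEig {Y : Module.End K V} {W : ℤ → Submodule K V} (h : IsGrading Y W)
    (k : ℤ) : W k = lowEig Y k := h.2 k

/-- The grading `Y'` splits `(N, Y)` in Deligne's sense: `N = N₀ + R` where `N₀` commutes with
`Y'` and belongs to the standard triple `(e, Y - Y', N₀)`, and `R` commutes with `e` and has
negative `ad Y'`-weights. -/
structure DeligneSplit (N Y Y' N₀ e : Module.End K V) : Prop where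
  iSup_eq_top : ⨆ j, intEig Y' j = ⊤
  commute_N₀ : Commute Y' N₀
  commute_e : Commute Y' e
  triple : IsStdTriple e (Y - Y') N₀
  commute_sub : Commute (N - N₀) e
  sub_mem : N - N₀ ∈ lowEig (homAd Y' Y') (-1)

theorem DeligneSplit.commute {N Y Y' N₀ e : Module.End K V} (h : DeligneSplit N Y Y' N₀ e) :
    Commute Y' Y := by
  have h₁ : Commute Y' (Y - Y') := by
    rw [← h.triple.2.1]
    exact (h.commute_e.mul_right h.commute_N₀).sub_right (h.commute_N₀.mul_right h.commute_e)
  simpa using h₁.add_right (Commute.refl Y')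

variable [CharZero K]

theorem IsStdTriple.apply_eq_smul_of_add_eq_zero [FiniteDimensional K V]
    {e h f D R : Module.End K V} (t : IsStdTriple e h f) (hD : ⨆ j, intEig D j = ⊤)
    (hDe : Commute D e) (hDh : Commute D h) (hDf : Commute D f) (hRe : Commute R e)
    (hR : ∀ m, ∀ x ∈ lowEig D m, R x ∈ lowEig D (m - 1)) {s : ℤ} {x : V}
    (hx : x ∈ lowEig D s) (hs : h x + D x = (s : K) • x) (hker : f x + R x = 0) :
    D x = (s : K) • x := by
  have hPe := intProj_comm hD (f := e) (fun v => LinearMap.congr_fun hDe v)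
  have hPh := intProj_comm hD (f := h) (fun v => LinearMap.congr_fun hDh v)
  have hPf := intProj_comm hD (f := f) (fun v => LinearMap.congr_fun hDf v)
  have hPD := intProj_comm hD (f := D) (fun _ => rfl)
  have hweight : ∀ j, h (intProj D j x) = ((s - j : ℤ) : K) • intProj D j x := by
    intro j
    rw [← hPh, eq_sub_of_add_eq hs, map_sub, map_smul, hPD, apply_intProj, ← sub_smul]
    push_cast
    rfl
  have hker' : ∀ j, f (intProj D j x) + intProj D j (R x) = 0 := fun j => by
    rw [← hPf, ← map_add, hker, map_zero]
  set y := intProj D s x with hy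
  have hfy : f y = 0 := by
    have := hker' s
    rwa [intProj_of_mem_lowEig (by omega) (hR s x hx), add_zero] at this
  have hey : e y = 0 := by
    refine t.apply_e_eq_zero ?_ hfy
    rw [hy, hweight, sub_self, Int.cast_zero, zero_smul]
  have key : ∀ k : ℕ, x - y ∈ lowEig D (s - 1 - k) := by
    intro k
    induction k with
    | zero => simpa using sub_intProj_mem_lowEig hD hx
    | succ k ih =>
      have hPy : intProj D (s - 1 - k) (x - y) = intProj D (s - 1 - k) x := by
        rw [map_sub, hy, intProj_of_mem_ne (by omega) (intProj_mem D s x), sub_zero]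
      have hzero : intProj D (s - 1 - k) x = 0 := by
        refine t.eq_zero_of_e_f (k := k + 1) (by omega) ?_ ?_
        · rw [hweight]
          congr 2
          ring
        · have h₁ := hker' (s - 1 - k)
          have h₂ : R x = R y + R (x - y) := by rw [← map_add]; congr 1; abel
          rw [h₂, map_add, intProj_of_mem_lowEig (by omega) (hR _ _ ih), add_zero] at h₁
          have h₃ := congrArg e h₁
          have h₄ : e (R y) = R (e y) := (LinearMap.congr_fun hRe y).symm
          rwa [map_add, ← hPe, h₄, hey, map_zero, map_zero, add_zero, map_zero] at h₃
      have := mem_lowEig_sub_one hD ih (hPy.trans hzero)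
      convert this using 2
      push_cast
      ring
  obtain ⟨n, hn, -⟩ := lowEig_eq_bot_top hD
  have hxy : x - y ∈ lowEig D (-n) :=
    lowEig_mono D (by have := le_abs_self s; push_cast; omega)
      (key (n + s.natAbs))
  rw [hn, Submodule.mem_bot, sub_eq_zero] at hxy
  rw [hxy, hy]
  exact apply_intProj D s x

/-- Morphisms are compatible with the Deligne gradings. -/
theorem DeligneSplit.mem_intEig_homAd [FiniteDimensional K V₁] [FiniteDimensional K V₂]
    {N₁ Y₁ Y₁' N₀₁ e₁ : Module.End K V₁} {N₂ Y₂ Y₂' N₀₂ e₂ : Module.End K V₂}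
    (h₁ : DeligneSplit N₁ Y₁ Y₁' N₀₁ e₁) (h₂ : DeligneSplit N₂ Y₂ Y₂' N₀₂ e₂)
    {f : V₁ →ₗ[K] V₂} {s : ℤ} (hY : f ∈ intEig (homAd Y₁ Y₂) s)
    (hN : ∀ v, N₂ (f v) = f (N₁ v))
    (hf : ∀ k, ∀ v ∈ lowEig Y₁' k, f v ∈ lowEig Y₂' (k + s)) :
    f ∈ intEig (homAd Y₁' Y₂') s := by
  have hlow := mem_lowEig_homAd h₁.iSup_eq_top h₂.iSup_eq_top hf
  refine mem_intEig.2 ((h₁.triple.homAd h₂.triple).apply_eq_smul_of_add_eq_zero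
    (R := homAd (N₁ - N₀₁) (N₂ - N₀₂)) (iSup_intEig_homAd h₁.iSup_eq_top h₂.iSup_eq_top)
    (commute_homAd h₁.commute_e h₂.commute_e)
    (commute_homAd (h₁.commute.sub_right (Commute.refl _)) (h₂.commute.sub_right (Commute.refl _)))
    (commute_homAd h₁.commute_N₀ h₂.commute_N₀)
    (commute_homAd h₁.commute_sub h₂.commute_sub) ?_ hlow ?_ ?_)
  · intro m g hg
    refine mem_lowEig_homAd h₁.iSup_eq_top h₂.iSup_eq_top fun k v hv => ?_
    rw [homAd_apply]
    refine Submodule.sub_mem _ ?_ ?_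
    · have := apply_mem_lowEig h₂.sub_mem (apply_mem_lowEig hg hv)
      convert this using 2
      ring
    · have := apply_mem_lowEig hg (apply_mem_lowEig h₁.sub_mem hv)
      convert this using 2
      ring
  · rw [homAd_sub, LinearMap.sub_apply, mem_intEig.1 hY]
    abel
  · ext v
    simp only [LinearMap.add_apply, homAd_apply, LinearMap.sub_apply, LinearMap.zero_apply, map_sub,
      hN]
    abel

theorem Commute.intProj_comm {A B : Module.End K V} (h : Commute A B)
    (hA : ⨆ j, intEig A j = ⊤) (j : ℤ) (v : V) : intProj A j (B v) = B (intProj A j v) :=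
  _root_.intProj_comm hA (fun v => LinearMap.congr_fun h v) j v

theorem iSup_intEig_sub [FiniteDimensional K V] {Y Y' : Module.End K V}
    (hY : ⨆ j, intEig Y j = ⊤) (hY' : ⨆ j, intEig Y' j = ⊤) (h : Commute Y' Y) :
    ⨆ j, intEig (Y - Y') j = ⊤ := by
  refine top_le_iff.1 fun v _ => ?_
  refine mem_of_intProj_mem hY' fun k => mem_of_intProj_mem hY fun a => ?_
  refine (le_iSup (intEig (Y - Y')) (a - k)) (mem_intEig.2 ?_)
  rw [LinearMap.sub_apply, apply_intProj, ← h.symm.intProj_comm hY, apply_intProj, map_smul,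
    ← sub_smul]
  push_cast
  rfl

end DeligneSplit

section CommuteLowEig

variable {K V : Type} [Field K] [AddCommGroup V] [Module K V]

theorem apply_mem_lowEig_of_commute {A f : Module.End K V} (h : Commute A f) {k : ℤ} {v : V}
    (hv : v ∈ lowEig A k) : f v ∈ lowEig A k := by
  have hf : f ∈ intEig (homAd A A) 0 :=
    mem_intEig_homAd.2 fun v => by simpa using LinearMap.congr_fun h v
  simpa using apply_mem_lowEig (intEig_le_lowEig _ le_rfl hf) hv

end CommuteLowEig

section InitialGrading

variable {K V : Type} [Field K] [AddCommGroup V] [Module K V] [CharZero K]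
  [FiniteDimensional K V]

theorem exists_commute_projection {Y : Module.End K V} (hY : ⨆ j, intEig Y j = ⊤)
    {U : Submodule K V} (hU : ∀ u ∈ U, Y u ∈ U) :
    ∃ p : Module.End K V, Commute Y p ∧ (∀ v, p v ∈ U) ∧ ∀ u ∈ U, p u = u := by
  obtain ⟨U', hU'⟩ := U.exists_isCompl
  let q := Submodule.projection _ _ hU'
  obtain ⟨n, -, hn⟩ := exists_sum_intProj hY
  have hYπ : ∀ j v, intProj Y j (Y v) = (j : K) • intProj Y j v := fun j v => by
    rw [intProj_comm hY (f := Y) (fun _ => rfl), apply_intProj]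
  refine ⟨∑ j ∈ Finset.Icc (-(n : ℤ)) n, intProj Y j * q * intProj Y j, ?_, fun v => ?_,
    fun u hu => ?_⟩
  · refine Commute.sum_right _ _ _ fun j _ => ?_
    ext v
    simp only [Module.End.mul_apply]
    rw [apply_intProj, hYπ, map_smul, map_smul]
  · rw [LinearMap.sum_apply]
    exact Submodule.sum_mem _ fun j _ =>
      intProj_mem_of_forall_mem hY hU j (Submodule.projection_apply_mem hU' _)
  · conv_rhs => rw [← hn u]
    rw [LinearMap.sum_apply]
    refine Finset.sum_congr rfl fun j _ => ?_
    rw [Module.End.mul_apply, Module.End.mul_apply, Submodule.projection_apply_of_mem_left hU'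
      (intProj_mem_of_forall_mem hY hU j hu), intProj_of_mem hY (intProj_mem Y j u)]

theorem exists_isGrading_commute {W : ℤ → Submodule K V} (hW : IsIncFilt W)
    {Y : Module.End K V} (hY : ⨆ j, intEig Y j = ⊤) (hYW : ∀ k, ∀ v ∈ W k, Y v ∈ W k) :
    ∃ Z, IsGrading Z W ∧ Commute Z Y := by
  obtain ⟨hmono, ⟨a, ha⟩, b, hb⟩ := hW
  have key : ∀ n : ℕ, ∃ Z : Module.End K V, Commute Z Y ∧
      ∀ j ≤ a + n, W j ≤ ⨆ i ≤ j, intEig Z i ⊓ W i := by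
    intro n
    induction n with
    | zero => exact ⟨0, Commute.zero_left Y, fun j hj => (ha j (by simpa using hj)).le.trans bot_le⟩
    | succ n ih =>
      obtain ⟨Z, hZY, hZ⟩ := ih
      obtain ⟨p, hYp, hpW, hp⟩ := exists_commute_projection hY (hYW (a + n))
      let Z' : Module.End K V := Z * p + ((a + n + 1 : ℤ) : K) • (1 - p)
      have hZ' : ∀ i ≤ a + n, intEig Z i ⊓ W i ≤ intEig Z' i ⊓ W i := by
        rintro i hi v ⟨hv, hvW⟩
        refine ⟨mem_intEig.2 ?_, hvW⟩
        simp [Z', hp v (hmono hi hvW), mem_intEig.1 hv]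
      have hle : ∀ j ≤ a + n, W j ≤ ⨆ i ≤ j, intEig Z' i ⊓ W i := fun j hj =>
        (hZ j hj).trans (iSup₂_mono fun i hi => hZ' i (hi.trans hj))
      refine ⟨Z', ?_, fun j hj => ?_⟩
      · exact (hZY.mul_left hYp.symm).add_left
          (((Commute.one_left Y).sub_left hYp.symm).smul_left _)
      · rcases le_or_gt j (a + n) with h | h
        · exact hle j h
        · obtain rfl : j = a + n + 1 := by push_cast at hj; omega
          intro v hv
          have hpv : p v ∈ W (a + n + 1) := hmono (by omega) (hpW v)
          have hsub : v - p v ∈ intEig Z' (a + n + 1) ⊓ W (a + n + 1) := by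
            refine ⟨mem_intEig.2 ?_, sub_mem hv hpv⟩
            simp [Z', hp _ (hpW v)]
          rw [← sub_add_cancel v (p v)]
          refine add_mem ((le_iSup₂_of_le (f := fun i (_ : i ≤ a + n + 1) => intEig Z' i ⊓ W i)
            (a + n + 1) le_rfl le_rfl) hsub) ?_
          have hmono' : ⨆ i ≤ a + (n : ℤ), intEig Z' i ⊓ W i ≤
              ⨆ i ≤ a + (n : ℤ) + 1, intEig Z' i ⊓ W i :=
            biSup_mono fun i hi => by omega
          exact hmono' (hle (a + n) le_rfl (hpW v))
  obtain ⟨Z, hZY, hZ⟩ := key (b - a).toNat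
  set c := a + (b - a).toNat with hc
  have hctop : W c = ⊤ := hb c (by omega)
  have hZtop : ⨆ j, intEig Z j = ⊤ := by
    refine top_le_iff.1 ?_
    rw [← hctop]
    exact (hZ c le_rfl).trans (iSup₂_le fun i _ => inf_le_left.trans (le_iSup (intEig Z) i))
  have hZW : ∀ i, intEig Z i ≤ W i := by
    intro i v hv
    rcases le_or_gt c i with hi | hi
    · rw [hb i (by omega)]; exact Submodule.mem_top
    have hle : ⨆ l ≤ c, intEig Z l ⊓ W l ≤ (W i).comap (intProj Z i) := by
      refine iSup₂_le fun l _ w hw => ?_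
      rw [Submodule.mem_comap]
      by_cases hl : l = i
      · subst hl
        rw [intProj_of_mem hZtop hw.1]
        exact hw.2
      · rw [intProj_of_mem_ne hl hw.1]; exact zero_mem _
    have := hle (hZ c le_rfl (hctop ▸ Submodule.mem_top : v ∈ W c))
    rwa [Submodule.mem_comap, intProj_of_mem hZtop hv] at this
  refine ⟨Z, ⟨hZtop, fun k => le_antisymm ?_ (iSup₂_le fun i hi => (hZW i).trans (hmono hi))⟩, hZY⟩
  rcases le_or_gt k c with hk | hk
  · exact (hZ k hk).trans (iSup₂_mono fun i _ => inf_le_left)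
  · refine le_top.trans ?_
    rw [← hctop]
    refine (hZ c le_rfl).trans ((iSup₂_mono fun i _ => inf_le_left).trans ?_)
    exact biSup_mono fun i hi => hi.trans hk.le

end InitialGrading

section SlTwoPair

variable {K V : Type} [Field K] [AddCommGroup V] [Module K V]
  {W M : ℤ → Submodule K V} {N Y Y' N₀ : Module.End K V}

theorem pow_apply_sub_pow_apply_mem (hc : Commute Y' N₀)
    (hlow : N - N₀ ∈ lowEig (homAd Y' Y') (-1)) {k : ℤ} {x : V} (hx : x ∈ lowEig Y' k) (ℓ : ℕ) :
    (N ^ ℓ) x - (N₀ ^ ℓ) x ∈ lowEig Y' (k - 1) := by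
  induction ℓ with
  | zero => simp
  | succ ℓ ih =>
    have h₁ : (N - N₀) ((N ^ ℓ) x) ∈ lowEig Y' (k - 1) := by
      refine apply_mem_lowEig hlow ?_
      rw [← sub_add_cancel ((N ^ ℓ) x) ((N₀ ^ ℓ) x)]
      exact add_mem (lowEig_mono Y' (by omega) ih)
        (apply_mem_lowEig_of_commute (hc.pow_right ℓ) hx)
    have h₂ := apply_mem_lowEig_of_commute hc ih
    rw [pow_succ', pow_succ', Module.End.mul_apply, Module.End.mul_apply]
    convert add_mem h₁ h₂ using 1
    rw [LinearMap.sub_apply, map_sub]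
    abel

variable [CharZero K] [FiniteDimensional K V]

theorem IsRelWeightFilt.pow_injective (hrel : IsRelWeightFilt N W M) (hM : IsGrading Y M)
    (hW : IsGrading Y' W) (hcomm : Commute Y' Y) (hc : Commute Y' N₀)
    (hlow : N - N₀ ∈ lowEig (homAd Y' Y') (-1)) (ℓ : ℕ) {v : V} (hv : v ∈ intEig (Y - Y') ℓ)
    (hNv : (N₀ ^ ℓ) v = 0) : v = 0 := by
  refine (Submodule.mem_bot K).1 (mem_of_intProj_mem hW.1 fun k => ?_)
  rw [Submodule.mem_bot]
  set x := intProj Y' k v with hx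
  have hxW : x ∈ intEig Y' k := intProj_mem Y' k v
  have hxM : x ∈ intEig Y (k + ℓ) := by
    rw [mem_intEig, LinearMap.sub_apply, sub_eq_iff_eq_add] at hv
    rw [mem_intEig, hx, ← hcomm.intProj_comm hW.1, hv, map_add, map_smul,
      (Commute.refl Y').intProj_comm hW.1, apply_intProj, ← add_smul, Int.cast_add, add_comm]
  have hNx : (N₀ ^ ℓ) x = 0 := by
    rw [hx, ← (hc.pow_right ℓ).intProj_comm hW.1, hNv, map_zero]
  have hmem : x ∈ M (k + ℓ - 1) ⊓ W k ⊔ W (k - 1) := by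
    refine (hrel.2 k ℓ).2 ⟨⟨?_, ?_⟩, ?_⟩
    · rw [hM.eq_lowEig]; exact intEig_le_lowEig Y le_rfl hxM
    · rw [hW.eq_lowEig]; exact intEig_le_lowEig Y' le_rfl hxW
    · refine Submodule.mem_sup_right ?_
      have := pow_apply_sub_pow_apply_mem hc hlow (intEig_le_lowEig Y' le_rfl hxW) ℓ
      rwa [hNx, sub_zero, ← hW.eq_lowEig] at this
  obtain ⟨m, hm, w, hw, hmw⟩ := Submodule.mem_sup.1 hmem
  rw [hW.eq_lowEig] at hw
  have hm' := hm.1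
  rw [hM.eq_lowEig] at hm'
  have hcc : ∀ u, intProj Y (k + ℓ) (intProj Y' k u) = intProj Y' k (intProj Y (k + ℓ) u) :=
    intProj_comm hM.1 (fun u => (hcomm.intProj_comm hW.1 k u).symm) (k + ℓ)
  have h₁ : intProj Y (k + ℓ) (intProj Y' k x) = x := by
    rw [intProj_of_mem hW.1 hxW, intProj_of_mem hM.1 hxM]
  rw [← h₁, ← hmw, map_add, map_add, hcc m, intProj_of_mem_lowEig (by omega) hm',
    intProj_of_mem_lowEig (by omega) hw, map_zero, map_zero, add_zero]

theorem IsRelWeightFilt.pow_surjective (hrel : IsRelWeightFilt N W M) (hM : IsGrading Y M)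
    (hW : IsGrading Y' W) (hcomm : Commute Y' Y) (hc : Commute Y' N₀)
    (hlow : N - N₀ ∈ lowEig (homAd Y' Y') (-1)) (hYN : Y * N₀ - N₀ * Y = -(2 • N₀)) (ℓ : ℕ) {v : V}
    (hv : v ∈ intEig (Y - Y') (-ℓ)) : ∃ u ∈ intEig (Y - Y') ℓ, (N₀ ^ ℓ) u = v := by
  have hgoal : v ∈ (intEig (Y - Y') ℓ).map (N₀ ^ ℓ) := by
    refine mem_of_intProj_mem hW.1 fun k => ?_
    set y := intProj Y' k v with hy
    have hyW : y ∈ intEig Y' k := intProj_mem Y' k v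
    have hyM : y ∈ intEig Y (k - ℓ) := by
      rw [mem_intEig, LinearMap.sub_apply, sub_eq_iff_eq_add] at hv
      rw [mem_intEig, hy, ← hcomm.intProj_comm hW.1, hv, map_add, map_smul,
        (Commute.refl Y').intProj_comm hW.1, apply_intProj, ← add_smul, ← Int.cast_add]
      congr 2
      ring
    have hmem := (hrel.2 k ℓ).1 (show y ∈ M (k - ℓ) ⊓ W k by
      rw [hM.eq_lowEig, hW.eq_lowEig]
      exact ⟨intEig_le_lowEig Y le_rfl hyM, intEig_le_lowEig Y' le_rfl hyW⟩)
    obtain ⟨_, ⟨x, hx, rfl⟩, t, ht, hxt⟩ := Submodule.mem_sup.1 hmem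
    obtain ⟨m, hm, w, hw, rfl⟩ := Submodule.mem_sup.1 ht
    have hm' := hm.1
    have hx' := hx.2
    rw [hM.eq_lowEig] at hm'
    rw [hW.eq_lowEig] at hw hx'
    have hcc : ∀ a u, intProj Y a (intProj Y' k u) = intProj Y' k (intProj Y a u) := fun a =>
      intProj_comm hM.1 (fun u => (hcomm.intProj_comm hW.1 k u).symm) a
    refine ⟨intProj Y (k + ℓ) (intProj Y' k x), mem_intEig.2 ?_, ?_⟩
    · rw [LinearMap.sub_apply, apply_intProj, ← hcomm.symm.intProj_comm hM.1, apply_intProj,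
        map_smul, ← sub_smul]
      push_cast
      congr 1
      ring
    · have h₁ : intProj Y (k - ℓ) (intProj Y' k y) = y := by
        rw [intProj_of_mem hW.1 hyW, intProj_of_mem hM.1 hyM]
      have h₂ : intProj Y' k ((N ^ ℓ) x) = (N₀ ^ ℓ) (intProj Y' k x) := by
        rw [← (hc.pow_right ℓ).intProj_comm hW.1, ← sub_eq_zero, ← map_sub]
        exact intProj_of_mem_lowEig (by omega) (pow_apply_sub_pow_apply_mem hc hlow hx' ℓ)
      have h₃ := intProj_pow_apply hM.1 hYN (k + ℓ) ℓ (intProj Y' k x)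
      rw [show k + ℓ - 2 * ℓ = k - (ℓ : ℤ) by ring] at h₃
      rw [← h₃, ← h₂, ← h₁, ← hxt, map_add, map_add, map_add, map_add, hcc _ m,
        intProj_of_mem_lowEig (by omega) hm', intProj_of_mem_lowEig (by omega) hw, map_zero,
        map_zero, add_zero, add_zero]
  exact hgoal

end SlTwoPair

section Splitting

variable {K V : Type} [Field K] [AddCommGroup V] [Module K V] {N Y Y' N₀ e : Module.End K V}

theorem mem_intEig_homAd_iff {f : Module.End K V} {c : ℤ} :
    f ∈ intEig (homAd Y Y) c ↔ Y * f - f * Y = (c : K) • f := mem_intEig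

theorem mul_sub_mul_eq_neg_iff {f : Module.End K V} :
    Y * f - f * Y = -(2 • f) ↔ f ∈ intEig (homAd Y Y) (-2) := by
  rw [mem_intEig_homAd_iff, Int.cast_smul_eq_zsmul, neg_smul, ofNat_zsmul]

theorem commute_iff_mem_intEig {f : Module.End K V} :
    Commute Y f ↔ f ∈ intEig (homAd Y Y) 0 := by
  rw [mem_intEig_homAd_iff, Int.cast_zero, zero_smul, sub_eq_zero]
  rfl

theorem mul_mem_intEig_homAd {f g : Module.End K V} {a b : ℤ} (hf : f ∈ intEig (homAd Y Y) a)
    (hg : g ∈ intEig (homAd Y Y) b) : f * g ∈ intEig (homAd Y Y) (a + b) := by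
  rw [mem_intEig_homAd] at hf hg ⊢
  intro v
  rw [Module.End.mul_apply, Module.End.mul_apply, hf, hg, map_add, map_smul, Int.cast_add,
    add_smul, add_assoc, add_comm ((a : K) • _)]

theorem lowEig_conj (g : (Module.End K V)ˣ) (k : ℤ) :
    lowEig (g * Y * ↑g⁻¹ : Module.End K V) k = (lowEig Y k).map (g : Module.End K V) := by
  have h : ∀ j, intEig (g * Y * ↑g⁻¹ : Module.End K V) j
      = (intEig Y j).map (g : Module.End K V) := by
    intro j
    refine le_antisymm (fun v hv => ?_) ?_
    · refine ⟨(↑g⁻¹ : Module.End K V) v, ?_, ?_⟩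
      swap
      · rw [← Module.End.mul_apply, Units.mul_inv, Module.End.one_apply]
      rw [mem_intEig] at hv
      have := congrArg (↑g⁻¹ : Module.End K V) hv
      rw [map_smul] at this
      rw [SetLike.mem_coe, mem_intEig, ← this]
      simp only [← Module.End.mul_apply, ← mul_assoc, Units.inv_mul, one_mul]
    · rintro _ ⟨v, hv, rfl⟩
      rw [SetLike.mem_coe, mem_intEig] at hv
      rw [mem_intEig, ← map_smul, ← hv]
      simp only [← Module.End.mul_apply, mul_assoc, Units.inv_mul, mul_one]
  simp only [lowEig, h, Submodule.map_iSup]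

theorem one_mem_lowEig_homAd : (1 : Module.End K V) ∈ lowEig (homAd Y Y) 0 :=
  intEig_le_lowEig _ le_rfl (commute_iff_mem_intEig.1 (Commute.one_right Y))

variable [FiniteDimensional K V]

theorem map_unit_lowEig {g : (Module.End K V)ˣ}
    (hg : (g : Module.End K V) ∈ lowEig (homAd Y Y) 0) (k : ℤ) :
    (lowEig Y k).map (g : Module.End K V) = lowEig Y k := by
  refine Submodule.eq_of_le_of_finrank_eq ?_ ?_
  · rintro _ ⟨v, hv, rfl⟩
    simpa using apply_mem_lowEig hg hv
  · exact (Submodule.equivMapOfInjective _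
      ((Module.End.isUnit_iff _).1 g.isUnit).1 _).symm.finrank_eq

variable [CharZero K]

theorem mul_mem_lowEig_homAd (hY : ⨆ j, intEig Y j = ⊤) {f g : Module.End K V} {a b : ℤ}
    (hf : f ∈ lowEig (homAd Y Y) a) (hg : g ∈ lowEig (homAd Y Y) b) :
    f * g ∈ lowEig (homAd Y Y) (a + b) := by
  refine mem_lowEig_homAd hY hY fun k v hv => ?_
  have := apply_mem_lowEig hf (apply_mem_lowEig hg hv)
  rwa [add_assoc, add_comm b] at this

theorem unit_inv_mem_lowEig (hY : ⨆ j, intEig Y j = ⊤) {g : (Module.End K V)ˣ}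
    (hg : (g : Module.End K V) ∈ lowEig (homAd Y Y) 0) :
    (↑g⁻¹ : Module.End K V) ∈ lowEig (homAd Y Y) 0 := by
  refine mem_lowEig_homAd hY hY fun k v hv => ?_
  rw [← map_unit_lowEig hg] at hv
  obtain ⟨w, hw, rfl⟩ := hv
  rw [← Module.End.mul_apply, Units.inv_mul, add_zero]
  exact hw

theorem isNilpotent_of_mem_intEig_homAd (hY : ⨆ j, intEig Y j = ⊤) {f : Module.End K V} {m : ℤ}
    (hm : m < 0) (hf : f ∈ lowEig (homAd Y Y) m) : IsNilpotent f := by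
  obtain ⟨n, hn, -⟩ := lowEig_eq_bot_top (iSup_intEig_homAd hY hY)
  have hpow : ∀ i : ℕ, f ^ i ∈ lowEig (homAd Y Y) (i * m) := by
    intro i
    induction i with
    | zero => simpa using one_mem_lowEig_homAd
    | succ i ih =>
      rw [pow_succ]
      convert mul_mem_lowEig_homAd hY ih hf using 2
      push_cast
      ring
  refine ⟨n, (Submodule.mem_bot K).1 (hn ▸ lowEig_mono _ ?_ (hpow n))⟩
  nlinarith

theorem exists_sub_lie_mem_lowEig (hY : ⨆ j, intEig Y' j = ⊤) (hY'Y : Commute Y' Y)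
    (hN₀ : Commute Y' N₀) (he : Commute Y' e) (t : IsStdTriple e (Y - Y') N₀) {m : ℤ}
    (hm : m < 0) {δ : Module.End K V} (hδ : δ ∈ lowEig (homAd Y' Y') m)
    (hYδ : δ ∈ intEig (homAd Y Y) (-2)) :
    ∃ γ τ : Module.End K V, γ ∈ intEig (homAd Y' Y') m ∧ τ ∈ intEig (homAd Y' Y') m ∧
      Commute Y γ ∧ Commute τ e ∧ τ ∈ intEig (homAd Y Y) (-2) ∧
      δ - τ - (N₀ * γ - γ * N₀) ∈ lowEig (homAd Y' Y') (m - 1) := by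
  have hD := iSup_intEig_homAd hY hY
  have hDY := commute_homAd hY'Y hY'Y
  have hDH : Commute (homAd Y' Y') (homAd (Y - Y') (Y - Y')) :=
    commute_homAd (hY'Y.sub_right (Commute.refl Y')) (hY'Y.sub_right (Commute.refl Y'))
  set s := intProj (homAd Y' Y') m δ with hs
  have hsD : s ∈ intEig (homAd Y' Y') m := intProj_mem _ m δ
  have hYs : s ∈ intEig (homAd Y Y) (-2) := by
    rw [mem_intEig, hs, ← hDY.intProj_comm hD, mem_intEig.1 hYδ, map_smul]
  obtain ⟨γ₁, hγ₁, hE⟩ := (t.homAd t).exists_e_sub_eq_zero (k := -m) (by omega) (v := s) (by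
    rw [homAd_sub, LinearMap.sub_apply, mem_intEig.1 hYs, mem_intEig.1 hsD, ← sub_smul]
    push_cast
    congr 1
    ring)
  set γ := intProj (homAd Y' Y') m γ₁ with hγ
  have hγD : γ ∈ intEig (homAd Y' Y') m := intProj_mem _ m γ₁
  have hFγ : homAd N₀ N₀ γ = intProj (homAd Y' Y') m (homAd N₀ N₀ γ₁) :=
    ((commute_homAd hN₀ hN₀).intProj_comm hD m γ₁).symm
  have hEγ : homAd e e (s - homAd N₀ N₀ γ) = 0 := by
    have hPs := intProj_of_mem hD hsD
    rw [hFγ, ← hPs, ← map_sub, ← (commute_homAd he he).intProj_comm hD, hE, map_zero]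
  have hHγ : homAd (Y - Y') (Y - Y') γ = ((-m : ℤ) : K) • γ := by
    rw [hγ, ← hDH.intProj_comm hD, hγ₁, map_smul]
  have hYγ : γ ∈ intEig (homAd Y Y) 0 := by
    rw [homAd_sub, LinearMap.sub_apply, mem_intEig.1 hγD, sub_eq_iff_eq_add, ← add_smul] at hHγ
    rw [mem_intEig, hHγ]
    push_cast
    congr 1
    ring
  have hN₀Y : N₀ ∈ intEig (homAd Y Y) (-2) := by
    have := t.2.2
    rw [sub_mul, mul_sub, hN₀.eq, sub_sub_sub_cancel_right] at this
    exact mul_sub_mul_eq_neg_iff.1 this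
  refine ⟨γ, s - homAd N₀ N₀ γ, hγD, ?_, commute_iff_mem_intEig.2 hYγ, ?_, ?_, ?_⟩
  · exact sub_mem hsD (hFγ ▸ intProj_mem _ _ _)
  · exact (adE_eq_zero_iff.1 hEγ).symm
  · have h₁ := mul_mem_intEig_homAd hN₀Y hYγ
    have h₂ := mul_mem_intEig_homAd hYγ hN₀Y
    rw [add_zero] at h₁
    rw [zero_add] at h₂
    exact Submodule.sub_mem _ hYs (Submodule.sub_mem _ h₁ h₂)
  · convert sub_intProj_mem_lowEig hD hδ using 1
    change δ - (s - (N₀ * γ - γ * N₀)) - (N₀ * γ - γ * N₀) = δ - s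
    abel

theorem exists_unit_conj (hY : ⨆ j, intEig Y' j = ⊤) (hY'Y : Commute Y' Y)
    (hN₀ : Commute Y' N₀) (he : Commute Y' e) (t : IsStdTriple e (Y - Y') N₀)
    (hYN : N ∈ intEig (homAd Y Y) (-2)) (hN : N - N₀ ∈ lowEig (homAd Y' Y') (-1)) :
    ∃ g : (Module.End K V)ˣ, (g : Module.End K V) ∈ lowEig (homAd Y' Y') 0 ∧
      Commute Y (g : Module.End K V) ∧ Commute (↑g⁻¹ * N * g - N₀) e ∧
      ↑g⁻¹ * N * g - N₀ ∈ lowEig (homAd Y' Y') (-1) := by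
  have hN₀Y : N₀ ∈ intEig (homAd Y Y) (-2) := by
    have := t.2.2
    rw [sub_mul, mul_sub, hN₀.eq, sub_sub_sub_cancel_right] at this
    exact mul_sub_mul_eq_neg_iff.1 this
  have key : ∀ k : ℕ, ∃ (g : (Module.End K V)ˣ) (u : Module.End K V),
      (g : Module.End K V) ∈ lowEig (homAd Y' Y') 0 ∧ Commute Y (g : Module.End K V) ∧
      u ∈ lowEig (homAd Y' Y') (-1) ∧ Commute u e ∧ u ∈ intEig (homAd Y Y) (-2) ∧
      ↑g⁻¹ * N * g - N₀ - u ∈ lowEig (homAd Y' Y') (-1 - k) := by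
    intro k
    induction k with
    | zero =>
      exact ⟨1, 0, by simpa using one_mem_lowEig_homAd, by simp, zero_mem _,
        Commute.zero_left e, zero_mem _, by simpa using hN⟩
    | succ k ih =>
      obtain ⟨g, u, hg, hYg, hu, hue, hYu, hδ⟩ := ih
      set N' : Module.End K V := ↑g⁻¹ * N * g with hN'
      have hYgi : Commute Y (↑g⁻¹ : Module.End K V) := hYg.units_inv_right
      have hYN' : N' ∈ intEig (homAd Y Y) (-2) := by
        simpa using mul_mem_intEig_homAd
          (mul_mem_intEig_homAd (commute_iff_mem_intEig.1 hYgi) hYN)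
          (commute_iff_mem_intEig.1 hYg)
      obtain ⟨γ, τ, hγ, hτ, hYγ, hτe, hYτ, hlow⟩ := exists_sub_lie_mem_lowEig hY hY'Y hN₀ he t
        (by omega) hδ (sub_mem (sub_mem hYN' hN₀Y) hYu)
      have hγ' := intEig_le_lowEig (homAd Y' Y') le_rfl hγ
      obtain ⟨h, hh⟩ := (isNilpotent_of_mem_intEig_homAd hY (by omega) hγ').isUnit_one_sub
      have hhlow : (h : Module.End K V) ∈ lowEig (homAd Y' Y') 0 := by
        rw [hh]
        exact sub_mem one_mem_lowEig_homAd (lowEig_mono _ (by omega) hγ')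
      have hτlow : τ ∈ lowEig (homAd Y' Y') (-1) :=
        lowEig_mono _ (by omega) (intEig_le_lowEig _ le_rfl hτ)
      refine ⟨g * h, u + τ, ?_, ?_, add_mem hu hτlow, hue.add_left hτe, add_mem hYu hYτ, ?_⟩
      · simpa using mul_mem_lowEig_homAd hY hg hhlow
      · rw [Units.val_mul, hh]
        exact hYg.mul_right ((Commute.one_right Y).sub_right hYγ)
      · have heq : (↑(g * h)⁻¹ : Module.End K V) * N * ↑(g * h) - N₀ - (u + τ) = ↑h⁻¹ *
            ((N' - N₀ - u - τ - (N₀ * γ - γ * N₀)) - (N' - N₀) * γ + γ * (u + τ)) := by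
          have h₁ : (N' - N₀ - u - τ - (N₀ * γ - γ * N₀)) - (N' - N₀) * γ + γ * (u + τ)
              = N' * h - h * (N₀ + (u + τ)) := by
            rw [hh]
            noncomm_ring
          rw [h₁, mul_sub, ← mul_assoc (↑h⁻¹ : Module.End K V) (h : Module.End K V),
            Units.inv_mul, one_mul, sub_sub, mul_inv_rev, Units.val_mul, Units.val_mul, hN']
          simp only [mul_assoc]
        rw [heq]
        have hN'low : N' - N₀ ∈ lowEig (homAd Y' Y') (-1) := by
          rw [← sub_add_cancel (N' - N₀) u]
          exact add_mem (lowEig_mono _ (by omega) hδ) hu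
        have := mul_mem_lowEig_homAd hY (unit_inv_mem_lowEig hY hhlow)
          (add_mem (sub_mem hlow (lowEig_mono _ (by omega) (mul_mem_lowEig_homAd hY hN'low hγ')))
            (lowEig_mono (homAd Y' Y') (show _ ≤ (-1 - k - 1 : ℤ) by omega)
              (mul_mem_lowEig_homAd hY hγ' (add_mem hu hτlow))))
        convert this using 2
        push_cast
        ring
  obtain ⟨n, hn, -⟩ := lowEig_eq_bot_top (iSup_intEig_homAd hY hY)
  obtain ⟨g, u, hg, hYg, hu, hue, -, hlow⟩ := key n
  have hz := lowEig_mono _ (show (-1 - n : ℤ) ≤ -n by omega) hlow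
  rw [hn, Submodule.mem_bot, sub_eq_zero] at hz
  exact ⟨g, hg, hYg, hz ▸ hue, hz ▸ hu⟩

variable {W M : ℤ → Submodule K V}

/-- Existence of Deligne's grading for a one-variable Deligne system. -/
theorem exists_deligneSplit (hW : IsIncFilt W) (hM : IsGrading Y M)
    (hYW : ∀ k, ∀ v ∈ W k, Y v ∈ W k) (hNW : ∀ k, ∀ v ∈ W k, N v ∈ W k)
    (hYN : Y * N - N * Y = -(2 • N)) (hrel : IsRelWeightFilt N W M) :
    ∃ Y' N₀ e, IsGrading Y' W ∧ DeligneSplit N Y Y' N₀ e := by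
  obtain ⟨Y', hY', hcomm⟩ := exists_isGrading_commute hW hM.1 hYW
  have hD := iSup_intEig_homAd hY'.1 hY'.1
  have hDY := commute_homAd hcomm hcomm
  have hNlow : N ∈ lowEig (homAd Y' Y') 0 := mem_lowEig_homAd hY'.1 hY'.1 fun k v hv => by
    rw [← hY'.eq_lowEig] at hv ⊢
    simpa using hNW k v hv
  obtain ⟨N₀, hN₀⟩ : ∃ N₀ : Module.End K V, N₀ = intProj (homAd Y' Y') 0 N := ⟨_, rfl⟩
  have hsub : N - N₀ ∈ lowEig (homAd Y' Y') (-1) := by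
    have := sub_intProj_mem_lowEig hD hNlow
    rwa [zero_sub, ← hN₀] at this
  have hN₀Y' : Commute Y' N₀ := commute_iff_mem_intEig.2 (hN₀ ▸ intProj_mem _ 0 N)
  rw [mul_sub_mul_eq_neg_iff] at hYN
  have hN₀Y : Y * N₀ - N₀ * Y = -(2 • N₀) := by
    rw [mul_sub_mul_eq_neg_iff, mem_intEig, hN₀, ← hDY.intProj_comm hD, mem_intEig.1 hYN,
      map_smul]
  have hH : (Y - Y') * N₀ - N₀ * (Y - Y') = -(2 • N₀) := by
    rw [← hN₀Y, sub_mul, mul_sub, hN₀Y'.eq, sub_sub_sub_cancel_right]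
  obtain ⟨e, t⟩ := exists_isStdTriple (iSup_intEig_sub hM.1 hY'.1 hcomm) hH
    (fun ℓ v hv h => hrel.pow_injective hM hY' hcomm hN₀Y' hsub ℓ hv h)
    (fun ℓ v hv => hrel.pow_surjective hM hY' hcomm hN₀Y' hsub hN₀Y ℓ hv)
  have he : Commute Y' e := by
    have := (t.homAd t).apply_e_eq_zero (v := Y')
      (adE_eq_zero_iff.2 (hcomm.symm.sub_left (Commute.refl Y')))
      (adE_eq_zero_iff.2 hN₀Y'.symm)
    exact (adE_eq_zero_iff.1 this).symm
  obtain ⟨g, hg, hYg, hge, hglow⟩ := exists_unit_conj hY'.1 hcomm hN₀Y' he t hYN hsub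
  let φ : Module.End K V →+* Module.End K V :=
    MulSemiringAction.toRingHom (ConjAct (Module.End K V)ˣ) (Module.End K V) (ConjAct.toConjAct g)
  have hφ : ∀ x, φ x = g * x * ↑g⁻¹ := fun x => ConjAct.units_smul_def _ x
  have hφY : φ Y = Y := by rw [hφ, ← hYg.eq, mul_assoc, Units.mul_inv, mul_one]
  have hφN : N - φ N₀ = φ (↑g⁻¹ * N * g - N₀) := by
    rw [map_sub, hφ (_ * _), ← mul_assoc, ← mul_assoc, Units.mul_inv, one_mul, mul_assoc,
      Units.mul_inv, mul_one]
  have hlow : ∀ k, lowEig (φ Y') k = lowEig Y' k := fun k => by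
    rw [hφ, lowEig_conj, map_unit_lowEig hg]
  have htop : ⨆ j, intEig (φ Y') j = ⊤ := by
    obtain ⟨n, -, hn⟩ := lowEig_eq_bot_top hY'.1
    rw [← hlow] at hn
    exact top_le_iff.1 (hn ▸ lowEig_le fun j _ => le_iSup (intEig (φ Y')) j)
  refine ⟨φ Y', φ N₀, φ e, ⟨htop, fun k => (hY'.eq_lowEig k).trans (hlow k).symm⟩, htop,
    hN₀Y'.map φ, he.map φ, ?_, ?_, ?_⟩
  · obtain ⟨t₁, t₂, t₃⟩ := t
    refine ⟨?_, ?_, ?_⟩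
    · simpa only [map_sub, map_mul, map_nsmul, hφY] using congrArg φ t₁
    · simpa only [map_sub, map_mul, map_nsmul, hφY] using congrArg φ t₂
    · simpa only [map_sub, map_mul, map_nsmul, map_neg, hφY] using congrArg φ t₃
  · rw [hφN]
    exact hge.map φ
  · refine mem_lowEig_homAd htop htop fun k v hv => ?_
    rw [hlow] at hv ⊢
    have := mul_mem_lowEig_homAd hY'.1 (mul_mem_lowEig_homAd hY'.1 hg hglow)
      (unit_inv_mem_lowEig hY'.1 hg)
    rw [hφN, hφ]
    simpa using apply_mem_lowEig this hv

end Splitting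

section OneVariable

variable {K V : Type} [Field K] [AddCommGroup V] [Module K V]
  {W M : ℤ → Submodule K V} {N Y Y' Z N₀ e : Module.End K V}

theorem DeligneSplit.isZeroComponent (h : DeligneSplit N Y Y' N₀ e) :
    IsZeroComponent Y' N N₀ := by
  refine ⟨adE_eq_zero_iff.2 h.commute_N₀, ?_⟩
  have hle : lowEig (homAd Y' Y') (-1) ≤ ⨆ j ∈ {j : ℤ | j ≠ 0}, intEig (homAd Y' Y') j :=
    lowEig_le fun j hj => le_iSup₂_of_le j (by simp; omega) le_rfl
  exact hle h.sub_mem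

variable [CharZero K] [FiniteDimensional K V]

theorem HasDGP.exists_deligneSplit (h : HasDGP N Y Z) (hZ : IsGrading Z W)
    (hNW : ∀ k, ∀ v ∈ W k, N v ∈ W k) : ∃ N₀ e, DeligneSplit N Y Z N₀ e := by
  obtain ⟨N₀, e, ⟨h₀, hne⟩, he, t, hc⟩ := h
  rw [adE_eq_zero_iff] at h₀ he
  refine ⟨N₀, e, hZ.1, h₀, he, t, hc, ?_⟩
  have hD := iSup_intEig_homAd hZ.1 hZ.1
  have hNlow : N ∈ lowEig (homAd Z Z) 0 := mem_lowEig_homAd hZ.1 hZ.1 fun k v hv => by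
    rw [← hZ.eq_lowEig] at hv ⊢
    simpa using hNW k v hv
  have hlow : N - N₀ ∈ lowEig (homAd Z Z) 0 :=
    Submodule.sub_mem _ hNlow (intEig_le_lowEig _ le_rfl (commute_iff_mem_intEig.1 h₀))
  have := mem_lowEig_sub_one hD hlow (intProj_of_mem_iSup_ne hne)
  rwa [zero_sub] at this

theorem DeligneSplit.unique {N₁ e₁ : Module.End K V} (h : DeligneSplit N Y Y' N₀ e)
    (h₁ : DeligneSplit N Y Z N₁ e₁) (hY' : IsGrading Y' W) (hZ : IsGrading Z W) : Z = Y' := by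
  have := DeligneSplit.mem_intEig_homAd (s := 0) (f := (1 : Module.End K V)) h₁ h
    (_root_.mem_intEig_homAd.2 fun v => by simp) (fun v => rfl) fun k v hv => by
      rw [← hZ.eq_lowEig] at hv
      rw [← hY'.eq_lowEig, add_zero]
      exact hv
  rw [_root_.mem_intEig_homAd] at this
  ext v
  simpa using (this v).symm

theorem DeligneSplit.N₀_eq_intProj (h : DeligneSplit N Y Y' N₀ e) :
    intProj (homAd Y' Y') 0 N = N₀ := by
  have hD := iSup_intEig_homAd h.iSup_eq_top h.iSup_eq_top
  have h₁ := intProj_of_mem_lowEig (show (-1 : ℤ) < 0 by omega) h.sub_mem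
  rw [map_sub, sub_eq_zero] at h₁
  rw [h₁, intProj_of_mem hD (commute_iff_mem_intEig.1 h.commute_N₀)]

theorem DeligneSplit.commute_N₀_of_commute {X : Module.End K V} {s : ℤ}
    (h : DeligneSplit N Y Y' N₀ e) (hX : X ∈ intEig (homAd Y' Y') s) (hNX : Commute X N) :
    Commute X N₀ := by
  have hD := iSup_intEig_homAd h.iSup_eq_top h.iSup_eq_top
  have hX' : Y' * X - X * Y' = (s : K) • X := mem_intEig_homAd_iff.1 hX
  have := intProj_shift (f := homAd X X) (c := s) hD hD (fun f => by
    have := LinearMap.congr_fun (homAd_mul_sub_mul Y' X Y' X) f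
    rw [hX', LinearMap.sub_apply, sub_eq_iff_eq_add'] at this
    refine this.trans ?_
    congr 1
    ext v
    simp [homAd_apply, smul_sub]) 0 N
  have hXN : homAd X X N = 0 := adE_eq_zero_iff.2 hNX
  rw [hXN, map_zero, h.N₀_eq_intProj] at this
  exact adE_eq_zero_iff.1 this.symm

theorem DeligneSplit.N₀_apply_mem {U : Submodule K V} (h : DeligneSplit N Y Y' N₀ e)
    (hY'U : ∀ u ∈ U, Y' u ∈ U) (hNU : ∀ u ∈ U, N u ∈ U) : ∀ u ∈ U, N₀ u ∈ U := by
  have hD := iSup_intEig_homAd h.iSup_eq_top h.iSup_eq_top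
  have := intProj_mem_of_forall_mem hD (U := Submodule.compatibleMaps U U)
    (fun f hf u hu => Submodule.sub_mem _ (hY'U _ (hf hu)) (hf (hY'U _ hu))) 0 hNU
  rw [h.N₀_eq_intProj] at this
  exact this

theorem lowEig_restrict (hY : ⨆ j, intEig Y j = ⊤) {U : Submodule K V} (hU : ∀ u ∈ U, Y u ∈ U)
    (k : ℤ) : lowEig (Y.restrict hU) k = (lowEig Y k).comap U.subtype := by
  refine le_antisymm (lowEig_le fun j hj u hu => ?_) fun u hu => ?_
  · refine intEig_le_lowEig Y hj (mem_intEig.2 ?_)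
    exact congrArg Subtype.val (mem_intEig.1 hu)
  · obtain ⟨n, -, hn⟩ := exists_sum_intProj hY
    have hmem : ∀ j, intProj Y j u ∈ U := fun j => intProj_mem_of_forall_mem hY hU j u.2
    have : u = ∑ j ∈ Finset.Icc (-(n : ℤ)) n, (⟨intProj Y j u, hmem j⟩ : U) := by
      ext
      rw [AddSubmonoidClass.coe_finsetSum]
      exact (hn u).symm
    rw [this]
    refine Submodule.sum_mem _ fun j _ => ?_
    rcases le_or_gt j k with hj | hj
    · refine intEig_le_lowEig _ hj (mem_intEig.2 (Subtype.ext ?_))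
      exact apply_intProj Y j u
    · have hzero : (⟨intProj Y j u, hmem j⟩ : U) = 0 :=
        Subtype.ext (intProj_of_mem_lowEig hj hu)
      rw [hzero]
      exact zero_mem _

theorem IsGrading.restrict (h : IsGrading Y M) {U : Submodule K V} (hU : ∀ u ∈ U, Y u ∈ U) :
    IsGrading (Y.restrict hU) (fun k => (M k).comap U.subtype) := by
  refine ⟨?_, fun k => ?_⟩
  · obtain ⟨n, -, hn⟩ := lowEig_eq_bot_top h.1
    have := lowEig_restrict h.1 hU n
    rw [hn, Submodule.comap_top] at this
    exact top_le_iff.1 (this ▸ lowEig_le fun j _ => le_iSup (intEig (Y.restrict hU)) j)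
  · change (M k).comap U.subtype = _
    rw [h.eq_lowEig, ← lowEig_restrict h.1 hU]
    rfl

theorem DeligneSplit.apply_mem {U : Submodule K V} (h : DeligneSplit N Y Y' N₀ e)
    (hY' : IsGrading Y' W) (hW : IsIncFilt W) (hM : IsGrading Y M)
    (hYW : ∀ k, ∀ v ∈ W k, Y v ∈ W k) (hNW : ∀ k, ∀ v ∈ W k, N v ∈ W k)
    (hYN : Y * N - N * Y = -(2 • N)) (hYU : ∀ u ∈ U, Y u ∈ U) (hNU : ∀ u ∈ U, N u ∈ U)
    (hrel : IsRelWeightFilt (N.restrict hNU) (fun k => (W k).comap U.subtype)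
      (fun k => (M k).comap U.subtype)) : ∀ u ∈ U, Y' u ∈ U := by
  have hWU : IsIncFilt fun k => (W k).comap U.subtype := by
    obtain ⟨hmono, ⟨a, ha⟩, b, hb⟩ := hW
    refine ⟨fun _ _ hij => Submodule.comap_mono (hmono hij), ⟨a, fun k hk => ?_⟩, b,
      fun k hk => ?_⟩
    · simp [ha k hk, LinearMap.ker_eq_bot.2 U.subtype_injective]
    · simp [hb k hk]
  obtain ⟨Z, N₁, e₁, hZ, h₁⟩ :=
    _root_.exists_deligneSplit (Y := Y.restrict hYU) hWU (hM.restrict hYU)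
    (fun k v hv => hYW k v hv) (fun k v hv => hNW k v hv)
    (LinearMap.ext fun u => Subtype.ext (by simpa using LinearMap.congr_fun hYN (u : V))) hrel
  have := DeligneSplit.mem_intEig_homAd (s := 0) (f := U.subtype) h₁ h
    (_root_.mem_intEig_homAd.2 fun v => by simp) (fun v => rfl) fun k v hv => by
      rw [← hZ.eq_lowEig] at hv
      rw [← hY'.eq_lowEig, add_zero]
      exact hv
  rw [_root_.mem_intEig_homAd] at this
  intro u hu
  have hu' := this ⟨u, hu⟩
  simp only [Submodule.subtype_apply, Int.cast_zero, zero_smul, add_zero] at hu'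
  rw [hu']
  exact Submodule.coe_mem _

end OneVariable

section SeveralVariables

variable {K V : Type} [Field K] [AddCommGroup V] [Module K V]

/-- The conditions on filtrations `W⁰, …, W^r` and endomorphisms `N₁, …, N_r` that make them a
Deligne system once a suitable grading of `W^r` is given. -/
structure IsDeligneFamily (r : ℕ) (W : ℕ → ℤ → Submodule K V) (N : ℕ → Module.End K V) :
    Prop where
  isIncFilt : ∀ j ≤ r, IsIncFilt (W j)
  commute : ∀ i j, 1 ≤ i → i ≤ r → 1 ≤ j → j ≤ r → Commute (N i) (N j)
  rel : ∀ j < r, IsRelWeightFilt (N (j + 1)) (W j) (W (j + 1))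
  rel_restrict : ∀ j < r, ∀ k < j, ∀ ℓ : ℤ, ∀ hU : ∀ x ∈ W k ℓ, N (j + 1) x ∈ W k ℓ,
    IsRelWeightFilt ((N (j + 1)).restrict hU)
      (fun m => (W j m).comap (W k ℓ).subtype) (fun m => (W (j + 1) m).comap (W k ℓ).subtype)
  apply_mem : ∀ j, 1 ≤ j → j ≤ r → ∀ k ≤ r, ∀ ℓ : ℤ, ∀ v ∈ W k ℓ, N j v ∈ W k ℓ
  apply_mem_sub_two : ∀ j, 1 ≤ j → j ≤ r → ∀ k ≤ r, j ≤ k → ∀ ℓ : ℤ, ∀ v ∈ W k ℓ,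
    N j v ∈ W k (ℓ - 2)

/-- `Y` makes `(W⁰, …, W^m; N₁, …, N_m)` a Deligne system. -/
structure IsDeligneGrading (W : ℕ → ℤ → Submodule K V) (N : ℕ → Module.End K V) (m : ℕ)
    (Y : Module.End K V) : Prop where
  isGrading : IsGrading Y (W m)
  apply_mem : ∀ k ≤ m, ∀ ℓ : ℤ, ∀ v ∈ W k ℓ, Y v ∈ W k ℓ
  lie : ∀ j, 1 ≤ j → j ≤ m → Y * N j - N j * Y = -(2 • N j)

/-- `X` is an endomorphism of the Deligne system `(W⁰, …, W^m; N₁, …, N_m; Y)`. -/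
structure IsDeligneEnd (W : ℕ → ℤ → Submodule K V) (N : ℕ → Module.End K V) (m : ℕ)
    (Y X : Module.End K V) : Prop where
  commute : Commute Y X
  commute_N : ∀ j, 1 ≤ j → j ≤ m → Commute (N j) X
  apply_mem : ∀ k ≤ m, ∀ ℓ : ℤ, ∀ v ∈ W k ℓ, X v ∈ W k ℓ

variable {r : ℕ} {W : ℕ → ℤ → Submodule K V} {N : ℕ → Module.End K V} {n : ℕ}
  {Y Y' N₀ e X : Module.End K V}

theorem IsDeligneGrading.isDeligneEnd_sub (hY : IsDeligneGrading W N (n + 1) Y)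
    (hY' : IsDeligneGrading W N n Y') (h : Commute Y' Y) : IsDeligneEnd W N n Y' (Y - Y') := by
  refine ⟨h.sub_right (Commute.refl Y'), fun j hj hjn => ?_, fun k hk ℓ v hv =>
    Submodule.sub_mem _ (hY.apply_mem k (by omega) ℓ v hv) (hY'.apply_mem k hk ℓ v hv)⟩
  have := (hY.lie j hj (by omega)).trans (hY'.lie j hj hjn).symm
  rw [sub_eq_sub_iff_sub_eq_sub] at this
  rw [Commute, SemiconjBy, mul_sub, sub_mul, this]

variable [CharZero K] [FiniteDimensional K V]

theorem IsDeligneFamily.exists_deligneSplit (hF : IsDeligneFamily r W N) (hn : n < r)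
    (hY : IsDeligneGrading W N (n + 1) Y) :
    ∃ Y' N₀ e, IsGrading Y' (W n) ∧ DeligneSplit (N (n + 1)) Y Y' N₀ e :=
  _root_.exists_deligneSplit (hF.isIncFilt n hn.le) hY.isGrading (hY.apply_mem n (by omega))
    (hF.apply_mem (n + 1) (by omega) hn n hn.le) (hY.lie (n + 1) (by omega) le_rfl) (hF.rel n hn)

theorem IsDeligneFamily.isDeligneGrading (hF : IsDeligneFamily r W N) (hn : n < r)
    (hY : IsDeligneGrading W N (n + 1) Y) (hY' : IsGrading Y' (W n))
    (h : DeligneSplit (N (n + 1)) Y Y' N₀ e) : IsDeligneGrading W N n Y' := by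
  refine ⟨hY', fun k hk ℓ => ?_, fun j hj hjn => ?_⟩
  · rcases hk.lt_or_eq with hk | rfl
    · have hNU := hF.apply_mem (n + 1) (by omega) hn k (by omega) ℓ
      exact h.apply_mem hY' (hF.isIncFilt n hn.le) hY.isGrading (hY.apply_mem n (by omega))
        (hF.apply_mem (n + 1) (by omega) hn n hn.le) (hY.lie (n + 1) (by omega) le_rfl)
        (hY.apply_mem k (by omega) ℓ) hNU (hF.rel_restrict n hn k hk ℓ hNU)
    · intro v hv
      rw [hY'.eq_lowEig] at hv ⊢
      exact apply_mem_lowEig_of_commute (Commute.refl Y') hv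
  · refine mul_sub_mul_eq_neg_iff.2 (DeligneSplit.mem_intEig_homAd h h
      (mul_sub_mul_eq_neg_iff.1 (hY.lie j hj (by omega)))
      (fun v => LinearMap.congr_fun (hF.commute (n + 1) j (by omega) hn hj (by omega)) v)
      fun k v hv => ?_)
    rw [← hY'.eq_lowEig] at hv ⊢
    exact hF.apply_mem_sub_two j hj (by omega) n hn.le hjn k v hv

theorem IsDeligneFamily.isDeligneEnd_N₀ (hF : IsDeligneFamily r W N) (hn : n < r)
    (hY' : IsDeligneGrading W N n Y') (h : DeligneSplit (N (n + 1)) Y Y' N₀ e) :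
    IsDeligneEnd W N n Y' N₀ :=
  ⟨h.commute_N₀, fun j hj hjn => h.commute_N₀_of_commute
    (mul_sub_mul_eq_neg_iff.1 (hY'.lie j hj hjn))
    (hF.commute j (n + 1) hj (by omega) (by omega) hn),
    fun k hk ℓ => h.N₀_apply_mem (hY'.apply_mem k hk ℓ)
      (hF.apply_mem (n + 1) (by omega) hn k (by omega) ℓ)⟩

theorem IsDeligneEnd.commute_N₀ (hX : IsDeligneEnd W N (n + 1) Y X)
    (hY' : IsDeligneEnd W N n Y' X) (h : DeligneSplit (N (n + 1)) Y Y' N₀ e) : Commute X N₀ :=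
  h.commute_N₀_of_commute (commute_iff_mem_intEig.1 hY'.commute)
    (hX.commute_N (n + 1) (by omega) le_rfl).symm

theorem IsDeligneEnd.of_succ (hX : IsDeligneEnd W N (n + 1) Y X) (hY' : IsGrading Y' (W n))
    (h : DeligneSplit (N (n + 1)) Y Y' N₀ e) : IsDeligneEnd W N n Y' X := by
  refine ⟨?_, fun j hj hjn => hX.commute_N j hj (by omega),
    fun k hk => hX.apply_mem k (by omega)⟩
  refine commute_iff_mem_intEig.2 (DeligneSplit.mem_intEig_homAd h h
    (commute_iff_mem_intEig.1 hX.commute)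
    (fun v => LinearMap.congr_fun (hX.commute_N (n + 1) (by omega) le_rfl) v) fun k v hv => ?_)
  rw [← hY'.eq_lowEig] at hv ⊢
  rw [add_zero]
  exact hX.apply_mem n (by omega) k v hv

theorem exists_downward_rec {α : Type} (F : ℕ → α → α) (a : α) (r : ℕ) :
    ∃ f : ℕ → α, f r = a ∧ ∀ j < r, f j = F j (f (j + 1)) := by
  let g : ℕ → α := fun i => Nat.rec a (fun i x => F (r - (i + 1)) x) i
  refine ⟨fun j => g (r - j), by simp [g], fun j hj => ?_⟩
  have h₁ : r - j = (r - (j + 1)) + 1 := by omega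
  have h₂ : r - (r - (j + 1) + 1) = j := by omega
  change g (r - j) = F j (g (r - (j + 1)))
  rw [h₁]
  change F (r - (r - (j + 1) + 1)) (g (r - (j + 1))) = _
  rw [h₂]

theorem IsDeligneFamily.exists_sequence (hF : IsDeligneFamily r W N)
    (hY : IsDeligneGrading W N r Y) :
    ∃ Z N₀ e : ℕ → Module.End K V, Z r = Y ∧ (∀ j ≤ r, IsDeligneGrading W N j (Z j)) ∧
      ∀ j < r, DeligneSplit (N (j + 1)) (Z (j + 1)) (Z j) (N₀ j) (e j) := by
  have hstep : ∀ n Y, ∃ Y' N₀ e : Module.End K V, n < r → IsDeligneGrading W N (n + 1) Y →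
      IsDeligneGrading W N n Y' ∧ DeligneSplit (N (n + 1)) Y Y' N₀ e := by
    intro n Y
    by_cases hn : n < r ∧ IsDeligneGrading W N (n + 1) Y
    · obtain ⟨Y', N₀, e, hY', h⟩ := hF.exists_deligneSplit hn.1 hn.2
      exact ⟨Y', N₀, e, fun _ _ => ⟨hF.isDeligneGrading hn.1 hn.2 hY' h, h⟩⟩
    · exact ⟨0, 0, 0, fun h₁ h₂ => (hn ⟨h₁, h₂⟩).elim⟩
  choose F G E hFGE using hstep
  obtain ⟨Z, hZr, hZ⟩ := exists_downward_rec F Y r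
  have hgr : ∀ j ≤ r, IsDeligneGrading W N j (Z j) := by
    intro j hj
    induction hj using Nat.decreasingInduction with
    | self => rwa [hZr]
    | of_succ j hj ih =>
      rw [hZ j hj]
      exact (hFGE j _ hj ih).1
  refine ⟨Z, fun j => G j (Z (j + 1)), fun j => E j (Z (j + 1)), hZr, hgr, fun j hj => ?_⟩
  rw [hZ j hj]
  exact (hFGE j _ hj (hgr (j + 1) hj)).2

section Sequence

variable {Z Nh E : ℕ → Module.End K V}

theorem IsDeligneEnd.of_le (hZ : ∀ j ≤ r, IsDeligneGrading W N j (Z j))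
    (h : ∀ j < r, DeligneSplit (N (j + 1)) (Z (j + 1)) (Z j) (Nh j) (E j)) {i m : ℕ} (hm : m ≤ r)
    (hX : IsDeligneEnd W N m (Z m) X) (hi : i ≤ m) : IsDeligneEnd W N i (Z i) X := by
  induction hi using Nat.decreasingInduction with
  | self => exact hX
  | of_succ i hi ih => exact ih.of_succ (hZ i (by omega)).isGrading (h i (by omega))

theorem IsDeligneEnd.commute_of_lt (hZ : ∀ j ≤ r, IsDeligneGrading W N j (Z j))
    (h : ∀ j < r, DeligneSplit (N (j + 1)) (Z (j + 1)) (Z j) (Nh j) (E j)) {i m : ℕ} (hm : m ≤ r)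
    (hX : IsDeligneEnd W N m (Z m) X) (hi : i < m) : Commute X (Nh i) :=
  (hX.of_le hZ h hm (Nat.succ_le_of_lt hi)).commute_N₀ (hX.of_le hZ h hm hi.le) (h i (by omega))

theorem commute_of_le (hZ : ∀ j ≤ r, IsDeligneGrading W N j (Z j))
    (h : ∀ j < r, DeligneSplit (N (j + 1)) (Z (j + 1)) (Z j) (Nh j) (E j)) {i j : ℕ} (hj : j ≤ r)
    (hij : i ≤ j) : Commute (Z i) (Z j) := by
  induction j, hij using Nat.le_induction with
  | base => exact Commute.refl _
  | succ j hij ih =>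
    have hX := (hZ (j + 1) hj).isDeligneEnd_sub (hZ j (by omega)) (h j hj).commute
    simpa using (hX.of_le hZ h (by omega) hij).commute.add_right (ih (by omega))

end Sequence

end SeveralVariables

section Isomorphism

variable {K V : Type} [Field K] [AddCommGroup V] [Module K V] {W M : ℤ → Submodule K V}
  {N Y Y' N₀ e : Module.End K V}

theorem DeligneSplit.lie_N₀ (h : DeligneSplit N Y Y' N₀ e) : Y * N₀ - N₀ * Y = -(2 • N₀) := by
  have := h.triple.2.2
  rwa [sub_mul, mul_sub, h.commute_N₀.eq, sub_sub_sub_cancel_right] at this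

variable [CharZero K] [FiniteDimensional K V]

theorem DeligneSplit.map_pow_intEig (h : DeligneSplit N Y Y' N₀ e)
    (hrel : IsRelWeightFilt N W M) (hM : IsGrading Y M) (hW : IsGrading Y' W) (ℓ : ℕ) :
    (intEig (Y - Y') ℓ).map (N₀ ^ ℓ) = intEig (Y - Y') (-(ℓ : ℤ)) := by
  have hH := iSup_intEig_sub hM.1 hW.1 h.commute
  refine le_antisymm ?_ fun v hv =>
    hrel.pow_surjective hM hW h.commute h.commute_N₀ h.sub_mem h.lie_N₀ ℓ hv
  rintro _ ⟨v, hv, rfl⟩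
  have := intProj_pow_apply hH h.triple.2.2 ℓ ℓ v
  rw [intProj_of_mem hH hv, show (ℓ : ℤ) - 2 * ℓ = -ℓ by ring] at this
  rw [← this]
  exact intProj_mem _ _ _

theorem DeligneSplit.disjoint_ker_pow (h : DeligneSplit N Y Y' N₀ e)
    (hrel : IsRelWeightFilt N W M) (hM : IsGrading Y M) (hW : IsGrading Y' W) (ℓ : ℕ) :
    Disjoint (LinearMap.ker (N₀ ^ ℓ)) (intEig (Y - Y') ℓ) :=
  Submodule.disjoint_def.2 fun _ hker hv =>
    hrel.pow_injective hM hW h.commute h.commute_N₀ h.sub_mem ℓ hv hker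

end Isomorphism

/-- Deligne: Given a Deligne system datum of `r` variables
`(W⁰, …, W^r; N₁, …, N_r; Y^r)` satisfying axioms (a)–(e), there exist gradings
`Y^{r-1}, …, Y⁰` of `W^{r-1}, …, W⁰`, each `Y^{j-1}` being the unique grading of `W^{j-1}`
commuting with `Y^j` having the Deligne grading property for `(W^{j-1}, N_j, Y^j)`; the
gradings pairwise commute; and with `H_j = Y^j - Y^{j-1}` and `N̂_j` the `0`-component of
`N_j` for `ad Y^{j-1}`, the pairs `(N̂_j, H_j)` are commuting `sl₂`-pairs. -/
theorem stmt15 {K V : Type} [Field K] [CharZero K] [AddCommGroup V] [Module K V]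
    [FiniteDimensional K V] (r : ℕ)
    (W : ℕ → ℤ → Submodule K V) (N : ℕ → Module.End K V) (Yr : Module.End K V)
    (hfilt : ∀ j ≤ r, IsIncFilt (W j))
    (hnil : ∀ j, 1 ≤ j → j ≤ r → IsNilpotent (N j))
    (hNcomm : ∀ i j, 1 ≤ i → i ≤ r → 1 ≤ j → j ≤ r → N i * N j = N j * N i)
    (hYr : IsGrading Yr (W r))
    -- (a) each `N_j` preserves `W⁰`
    (ha : ∀ j, 1 ≤ j → j ≤ r → ∀ k : ℤ, Submodule.map (N j) (W 0 k) ≤ W 0 k)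
    -- (b) `W^j` is the relative weight filtration of `N_j` with respect to `W^{j-1}`
    (hb : ∀ j, 1 ≤ j → j ≤ r → IsRelWeightFilt (N j) (W (j - 1)) (W j))
    -- (c) for `0 ≤ k < j-1` and `U = W^k_ℓ`, the restriction of `W^j` to `U` is the relative
    -- weight filtration of `N_j|_U` with respect to `W^{j-1}|_U`
    (hc : ∀ j, 1 ≤ j → j ≤ r → ∀ k, k < j - 1 → ∀ ℓ : ℤ,
      ∀ hU : ∀ x ∈ W k ℓ, N j x ∈ W k ℓ,
        IsRelWeightFilt ((N j).restrict hU)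
          (fun m => (W (j - 1) m).comap (W k ℓ).subtype)
          (fun m => (W j m).comap (W k ℓ).subtype))
    -- (d) `N_j(W^k_ℓ) ⊆ W^k_ℓ` always, and `N_j(W^k_ℓ) ⊆ W^k_{ℓ-2}` if `k ≥ j`
    (hd1 : ∀ j, 1 ≤ j → j ≤ r → ∀ k ≤ r, ∀ ℓ : ℤ,
      Submodule.map (N j) (W k ℓ) ≤ W k ℓ)
    (hd2 : ∀ j, 1 ≤ j → j ≤ r → ∀ k ≤ r, j ≤ k → ∀ ℓ : ℤ,
      Submodule.map (N j) (W k ℓ) ≤ W k (ℓ - 2))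
    -- (e) `Y^r` preserves each `W^j` and `[Y^r, N_j] = -2 N_j`
    (he1 : ∀ j ≤ r, ∀ k : ℤ, Submodule.map Yr (W j k) ≤ W j k)
    (he2 : ∀ j, 1 ≤ j → j ≤ r → Yr * N j - N j * Yr = -(2 • N j)) :
    ∃ Y : ℕ → Module.End K V, ∃ Nh : ℕ → Module.End K V,
      Y r = Yr ∧
      -- each `Y^j` is a grading of `W^j`
      (∀ j ≤ r, IsGrading (Y j) (W j)) ∧
      -- the gradings pairwise commute
      (∀ i ≤ r, ∀ j ≤ r, Y i * Y j = Y j * Y i) ∧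
      -- `Y^{j-1}` is the unique grading of `W^{j-1}` commuting with `Y^j` which has the
      -- Deligne grading property for `(W^{j-1}, N_j, Y^j)`, with `N̂_j` the `0`-component
      (∀ j, 1 ≤ j → j ≤ r →
        (IsZeroComponent (Y (j - 1)) (N j) (Nh j) ∧
          ∃ Np : Module.End K V, adE (Y (j - 1)) Np = 0 ∧
            IsStdTriple Np (Y j - Y (j - 1)) (Nh j) ∧
            (N j - Nh j) * Np = Np * (N j - Nh j)) ∧
        (∀ Z : Module.End K V, IsGrading Z (W (j - 1)) → Z * Y j = Y j * Z →
          HasDGP (N j) (Y j) Z → Z = Y (j - 1))) ∧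
      -- with `H_j = Y^j - Y^{j-1}`, the `(N̂_j, H_j)` are commuting `sl₂`-pairs
      (∀ i, 1 ≤ i → i ≤ r → ∀ j, 1 ≤ j → j ≤ r →
        Nh i * Nh j = Nh j * Nh i ∧
        (Y i - Y (i - 1)) * (Y j - Y (j - 1)) = (Y j - Y (j - 1)) * (Y i - Y (i - 1)) ∧
        (i ≠ j → (Y i - Y (i - 1)) * Nh j = Nh j * (Y i - Y (i - 1)))) ∧
      (∀ j, 1 ≤ j → j ≤ r →
        (Y j - Y (j - 1)) * Nh j - Nh j * (Y j - Y (j - 1)) = -(2 • Nh j) ∧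
        ∀ ℓ : ℕ,
          Submodule.map (Nh j ^ ℓ) (intEig (Y j - Y (j - 1)) (ℓ : ℤ)) =
            intEig (Y j - Y (j - 1)) (-(ℓ : ℤ)) ∧
          Disjoint (LinearMap.ker (Nh j ^ ℓ)) (intEig (Y j - Y (j - 1)) (ℓ : ℤ))) := by
  have hF : IsDeligneFamily r W N := by
    refine ⟨hfilt, hNcomm, fun j hj => ?_, fun j hj k hk ℓ hU => ?_,
      fun j hj hjr k hk ℓ => Submodule.map_le_iff_le_comap.1 (hd1 j hj hjr k hk ℓ),
      fun j hj hjr k hk hjk ℓ => Submodule.map_le_iff_le_comap.1 (hd2 j hj hjr k hk hjk ℓ)⟩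
    · exact hb (j + 1) (by omega) hj
    · exact hc (j + 1) (by omega) hj k (by omega) ℓ hU
  obtain ⟨Z, Nh, E, hZr, hZ, h⟩ := hF.exists_sequence (Y := Yr)
    ⟨hYr, fun k hk ℓ => Submodule.map_le_iff_le_comap.1 (he1 k hk ℓ), he2⟩
  have hZZ : ∀ i ≤ r, ∀ j ≤ r, Commute (Z i) (Z j) := fun i hi j hj => by
    rcases le_total i j with hij | hij
    · exact commute_of_le hZ h hj hij
    · exact (commute_of_le hZ h hi hij).symm
  have hNN : ∀ i < r, IsDeligneEnd W N i (Z i) (Nh i) := fun i hi =>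
    hF.isDeligneEnd_N₀ hi (hZ i hi.le) (h i hi)
  refine ⟨Z, fun j => Nh (j - 1), hZr, fun j hj => (hZ j hj).isGrading, hZZ, ?_, ?_, ?_⟩
  · intro j hj hjr
    obtain ⟨n, rfl⟩ := Nat.exists_eq_succ_of_ne_zero (show j ≠ 0 by omega)
    have hn := h n hjr
    refine ⟨⟨hn.isZeroComponent, E n, adE_eq_zero_iff.2 hn.commute_e, hn.triple,
      hn.commute_sub⟩, fun Y' hY' _ hdgp => ?_⟩
    obtain ⟨N₀, e, h'⟩ := hdgp.exists_deligneSplit hY'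
      (hF.apply_mem (n + 1) hj hjr n (by omega))
    exact hn.unique h' (hZ n (by omega)).isGrading hY'
  · intro i hi hir j hj hjr
    obtain ⟨i, rfl⟩ := Nat.exists_eq_succ_of_ne_zero (show i ≠ 0 by omega)
    obtain ⟨j, rfl⟩ := Nat.exists_eq_succ_of_ne_zero (show j ≠ 0 by omega)
    simp only [Nat.succ_eq_add_one, Nat.add_sub_cancel]
    refine ⟨?_, ?_, fun hij => ?_⟩
    · rcases lt_trichotomy i j with hij | rfl | hij
      · exact ((hNN j hjr).commute_of_lt hZ h (by omega) hij).symm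
      · rfl
      · exact (hNN i hir).commute_of_lt hZ h (by omega) hij
    · have hc' : ∀ a ≤ r, Commute (Z a) (Z (j + 1) - Z j) := fun a ha =>
        (hZZ a ha _ hjr).sub_right (hZZ a ha _ (by omega))
      exact (hc' _ hir).sub_left (hc' _ (by omega))
    · rcases Nat.lt_or_gt_of_ne (fun h => hij (by rw [h]) : i ≠ j) with hij | hij
      · have hc' : ∀ a ≤ j, Commute (Z a) (Nh j) := fun a ha =>
          ((hNN j hjr).of_le hZ h (by omega) ha).commute
        exact (hc' _ hij).sub_left (hc' _ hij.le)
      · exact ((hZ (i + 1) hir).isDeligneEnd_sub (hZ i (by omega)) (h i hir).commute).commute_of_lt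
          hZ h (by omega) hij
  · intro j hj hjr
    obtain ⟨n, rfl⟩ := Nat.exists_eq_succ_of_ne_zero (show j ≠ 0 by omega)
    have hn := h n hjr
    exact ⟨hn.triple.2.2, fun ℓ =>
      ⟨hn.map_pow_intEig (hF.rel n hjr) (hZ _ hjr).isGrading (hZ n (by omega)).isGrading ℓ,
        hn.disjoint_ker_pow (hF.rel n hjr) (hZ _ hjr).isGrading (hZ n (by omega)).isGrading ℓ⟩⟩
end

section
/- Let Q be a skew-symmetric bilinear form on V = ℝ⁴ such that N₁ and N₂ are infinitesimal isometries of Q, let a ≥ 0, and suppose there is a real number C such that Q_ℂ(e₁(y), e₂(y)) = 0 for all y₁, y₂ > C. Then Q(f₁, f₂) = 0, Q(e₁, e₂) = 0, and Q(e₂, f₂) = 0. -/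
open Matrix

/-- The matrix of `N₁` on `ℝ⁴` in the ordered basis `(e₁, f₁, e₂, f₂)`:
`N₁e₁ = f₁`, `N₁e₂ = f₂`, `N₁f₁ = N₁f₂ = 0`. -/
def n1 : Matrix (Fin 4) (Fin 4) ℝ := !![0,0,0,0; 1,0,0,0; 0,0,0,0; 0,0,1,0]

/-- The matrix of `N₂`: `N₂e₁ = f₂`, `N₂f₁ = N₂e₂ = N₂f₂ = 0`. -/
def n2 : Matrix (Fin 4) (Fin 4) ℝ := !![0,0,0,0; 0,0,0,0; 0,0,0,0; 1,0,0,0]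

/-- The real bilinear form attached to the matrix `q`. -/
def Qr (q : Matrix (Fin 4) (Fin 4) ℝ) (u v : Fin 4 → ℝ) : ℝ := u ⬝ᵥ q.mulVec v

/-- The complexification `Q_ℂ` of the bilinear form attached to `q`. -/
noncomputable def Qc (q : Matrix (Fin 4) (Fin 4) ℝ) (u v : Fin 4 → ℂ) : ℂ :=
  u ⬝ᵥ (q.map (Complex.ofReal)).mulVec v

/-- `e₁(y) = e₁ + i(y₁ + a y₂) f₁ + i y₂ f₂` in coordinates `(e₁, f₁, e₂, f₂)`. -/
def e1y (a y₁ y₂ : ℝ) : Fin 4 → ℂ :=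
  ![1, (↑y₁ + ↑a * ↑y₂) * Complex.I, 0, ↑y₂ * Complex.I]

/-- `e₂(y) = e₂ + i(y₁ + a y₂) f₂`. -/
def e2y (a y₁ y₂ : ℝ) : Fin 4 → ℂ :=
  ![0, 0, 1, (↑y₁ + ↑a * ↑y₂) * Complex.I]

/-- Let `Q` be a skew-symmetric bilinear form on `ℝ⁴` such that `N₁` and `N₂`
are infinitesimal isometries of `Q`, let `a ≥ 0`, and suppose there is `C ∈ ℝ` such that
`Q_ℂ(e₁(y), e₂(y)) = 0` for all `y₁, y₂ > C`.  Then `Q(f₁, f₂) = 0`, `Q(e₁, e₂) = 0`, and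
`Q(e₂, f₂) = 0`. -/
theorem stmt16 (q : Matrix (Fin 4) (Fin 4) ℝ)
    (hskew : ∀ u v : Fin 4 → ℝ, Qr q u v = - Qr q v u)
    (h1 : ∀ u v : Fin 4 → ℝ, Qr q (n1.mulVec u) v + Qr q u (n1.mulVec v) = 0)
    (h2 : ∀ u v : Fin 4 → ℝ, Qr q (n2.mulVec u) v + Qr q u (n2.mulVec v) = 0)
    (a : ℝ) (ha : 0 ≤ a)
    (hC : ∃ C : ℝ, ∀ y₁ y₂ : ℝ, C < y₁ → C < y₂ →
      Qc q (e1y a y₁ y₂) (e2y a y₁ y₂) = 0) :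
    Qr q ![0,1,0,0] ![0,0,0,1] = 0 ∧
    Qr q ![1,0,0,0] ![0,0,1,0] = 0 ∧
    Qr q ![0,0,1,0] ![0,0,0,1] = 0 := by
  obtain ⟨C, hC⟩ := hC
  have h13 : q 1 3 = 0 := by
    simpa [Qr, n1, dotProduct, mulVec, Fin.sum_univ_four] using h1 ![1,0,0,0] ![0,0,0,1]
  have h12 : q 1 2 + q 0 3 = 0 := by
    simpa [Qr, n1, dotProduct, mulVec, Fin.sum_univ_four] using h1 ![1,0,0,0] ![0,0,1,0]
  have h33 : q 3 3 = 0 := by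
    have h := hskew ![0,0,0,1] ![0,0,0,1]
    simp [Qr, dotProduct, mulVec, Fin.sum_univ_four] at h
    linarith
  have h23 : q 2 3 = -q 3 2 := by
    simpa [Qr, dotProduct, mulVec, Fin.sum_univ_four] using hskew ![0,0,1,0] ![0,0,0,1]
  have hC_lt : C < |C| + 1 := by linarith [le_abs_self C]
  have h := hC (|C| + 1) (|C| + 1) hC_lt hC_lt
  have hre := congrArg Complex.re h
  have him := congrArg Complex.im h
  simp [Qc, e1y, e2y, dotProduct, mulVec, Fin.sum_univ_four, h13, h33] at hre him
  have h32 : (|C| + 1) * q 3 2 = 0 := by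
    linear_combination him - (|C| + 1 + a * (|C| + 1)) * h12
  have h32' : q 3 2 = 0 := (mul_eq_zero.mp h32).resolve_left (by positivity)
  simp [Qr, dotProduct, mulVec, Fin.sum_univ_four, h13, hre, h23, h32']
end

section
/- The subspace H = span_ℝ(e₂, f₂) of ℝ⁴ satisfies N₁(H) ⊆ H and N₂(H) ⊆ H, but there is no subspace U of ℝ⁴ with U ⊕ H = ℝ⁴, N₁(U) ⊆ U, and N₂(U) ⊆ U. In particular the corresponding Deligne–Hodge system is a non-semisimple object: H underlies a sub-object which is not a direct summand. -/
open Matrix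

/-- The subspace `H = span_ℝ(e₂, f₂)` of `ℝ⁴`. -/
def Hsub : Submodule ℝ (Fin 4 → ℝ) :=
  Submodule.span ℝ {![0,0,1,0], ![0,0,0,1]}

theorem mem_Hsub_iff {v : Fin 4 → ℝ} : v ∈ Hsub ↔ v 0 = 0 ∧ v 1 = 0 := by
  rw [Hsub, Submodule.mem_span_pair]
  constructor
  · rintro ⟨a, b, rfl⟩
    simp
  · rintro ⟨h0, h1⟩
    refine ⟨v 2, v 3, ?_⟩
    ext i
    fin_cases i <;> simp [h0, h1]

theorem n1_mulVec (v : Fin 4 → ℝ) : n1 *ᵥ v = ![0, v 0, 0, v 2] := by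
  ext i
  fin_cases i <;> simp [n1, mulVec, dotProduct, Fin.sum_univ_four]

theorem n2_mulVec (v : Fin 4 → ℝ) : n2 *ᵥ v = ![0, 0, 0, v 0] := by
  ext i
  fin_cases i <;> simp [n2, mulVec, dotProduct, Fin.sum_univ_four]

/-- `H = span_ℝ(e₂, f₂)` satisfies `N₁(H) ⊆ H` and `N₂(H) ⊆ H`, but no
subspace `U` of `ℝ⁴` with `U ⊕ H = ℝ⁴` satisfies `N₁(U) ⊆ U` and `N₂(U) ⊆ U`: the
corresponding Deligne–Hodge system is a non-semisimple object. -/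
theorem stmt18 :
    (Submodule.map n1.mulVecLin Hsub ≤ Hsub) ∧
    (Submodule.map n2.mulVecLin Hsub ≤ Hsub) ∧
    ¬ ∃ U : Submodule ℝ (Fin 4 → ℝ),
      (U ⊓ Hsub = ⊥ ∧ U ⊔ Hsub = ⊤) ∧
      Submodule.map n1.mulVecLin U ≤ U ∧
      Submodule.map n2.mulVecLin U ≤ U := by
  refine ⟨?_, ?_, ?_⟩
  · rintro _ ⟨v, hv, rfl⟩
    simp [mem_Hsub_iff, n1_mulVec, (mem_Hsub_iff.mp hv).1]
  · rintro _ ⟨v, -, rfl⟩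
    simp [mem_Hsub_iff, n2_mulVec]
  · rintro ⟨U, ⟨hinf, hsup⟩, -, hU⟩
    -- A vector of `U` with nonzero `e₁`-coordinate is sent by `N₂` to a nonzero multiple of `f₂`.
    have he : (![1, 0, 0, 0] : Fin 4 → ℝ) ∈ U ⊔ Hsub := hsup ▸ Submodule.mem_top
    obtain ⟨u, hu, h, hh, huh⟩ := Submodule.mem_sup.mp he
    have hu0 : u 0 = 1 := by
      simpa [(mem_Hsub_iff.mp hh).1] using congrFun huh 0
    have hf : n2 *ᵥ u ∈ U ⊓ Hsub :=
      ⟨hU ⟨u, hu, rfl⟩, by simp [mem_Hsub_iff, n2_mulVec]⟩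
    rw [hinf, Submodule.mem_bot, n2_mulVec] at hf
    simpa [hu0] using congrFun hf 3
end
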